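/- arXiv:1902.05875 — 6 statements merged into one kernel-verified Lean document; each statement's English description precedes it below -/
import Mathlib

section
/- Let k ∈ ℂ with k ≠ 0 and let r ∈ ℝ³ with r ≠ 0. Then there exists a radius a > 0 such that for every r' = (x', y', z') ∈ ℝ³ with ‖r'‖ ≤ a one has the absolutely convergent expansion h₀⁽¹⁾(k‖r − r'‖) = Σ_{n=0}^∞ Σ_{m=0}^{n} Σ_{s=0}^{m} α̃ₙₘˢ(r') · (𝒟̂ₙₘˢ H_k)(r, 0) / (2^m (n−m)! s! (m−s)!), where (𝒟̂ₙₘˢ H_k)(r, 0) denotes the indicated mixed partial derivative of H_k with respect to the source variable r', evaluated at r' = 0. -/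
open Complex Finset

noncomputable section

/-- Euclidean 3-space. -/
abbrev E3 := EuclideanSpace ℝ (Fin 3)

/-- Partial derivative of a complex-valued function along the `i`-th coordinate. -/
noncomputable def pd (i : Fin 3) (f : E3 → ℂ) : E3 → ℂ :=
  fun r => fderiv ℝ f r (EuclideanSpace.single i 1)

/-- The operator ∂/∂x + i ∂/∂y. -/
noncomputable def Dplus (f : E3 → ℂ) : E3 → ℂ := fun r => pd 0 f r + I * pd 1 f r

/-- The operator ∂/∂x − i ∂/∂y. -/
noncomputable def Dminus (f : E3 → ℂ) : E3 → ℂ := fun r => pd 0 f r - I * pd 1 f r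

/-- The mixed derivative 𝒟ₙₘˢ = (∂x − i∂y)^s (∂x + i∂y)^{m−s} (∂z)^{n−m}. -/
noncomputable def Dop (n m s : ℕ) (f : E3 → ℂ) : E3 → ℂ :=
  Dminus^[s] (Dplus^[m - s] ((pd 2)^[n - m] f))

/-- Order-zero spherical Hankel function of the first kind: h₀⁽¹⁾(w) = e^{iw}/(iw). -/
noncomputable def h0 (w : ℂ) : ℂ := Complex.exp (I * w) / (I * w)

/-- H_k(r, r') = h₀⁽¹⁾(k‖r − r'‖). -/
noncomputable def Hk (k : ℂ) (r r' : E3) : ℂ := h0 (k * (‖r - r'‖ : ℝ))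

/-- The symmetric Taylor monomial α̃ₙₘˢ(r') = (x'+iy')^s (x'−iy')^{m−s} (z')^{n−m}. -/
noncomputable def tAlpha (n m s : ℕ) (r : E3) : ℂ :=
  ((r 0 : ℂ) + I * (r 1 : ℂ)) ^ s * ((r 0 : ℂ) - I * (r 1 : ℂ)) ^ (m - s) *
    ((r 2 : ℂ)) ^ (n - m)

/-- The complex vector space of functions that are real-analytic on `U` and vanish off `U`. -/
def analyticOnSubmodule (U : Set E3) : Submodule ℂ (E3 → ℂ) where
  carrier := {f | AnalyticOnNhd ℝ f U ∧ ∀ x ∉ U, f x = 0}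
  add_mem' := fun hf hg =>
    ⟨hf.1.add hg.1, fun x hx => by simp [hf.2 x hx, hg.2 x hx]⟩
  zero_mem' := ⟨analyticOnNhd_const, fun _ _ => rfl⟩
  smul_mem' := fun c _ hf =>
    ⟨(analyticOnNhd_const (v := c)).mul hf.1, fun x hx => by simp [hf.2 x hx]⟩

theorem AnalyticOnNhd.indicator_mem_analyticOnSubmodule {U : Set E3} (hU : IsOpen U)
    {f : E3 → ℂ} (hf : AnalyticOnNhd ℝ f U) : U.indicator f ∈ analyticOnSubmodule U :=
  ⟨hf.congr hU fun _ hx => (Set.indicator_of_mem hx f).symm,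
    fun _ hx => Set.indicator_of_notMem hx f⟩

theorem AnalyticOnNhd.fderiv_apply_const {U : Set E3} {f : E3 → ℂ}
    (hf : AnalyticOnNhd ℝ f U) (v : E3) : AnalyticOnNhd ℝ (fun x => fderiv ℝ f x v) U :=
  fun x hx => ((ContinuousLinearMap.apply ℝ ℂ v).analyticAt _).comp (hf.fderiv x hx)

theorem fderiv_eq_of_eqOn {U : Set E3} (hU : IsOpen U) {f g : E3 → ℂ} (h : Set.EqOn f g U)
    {x : E3} (hx : x ∈ U) : fderiv ℝ f x = fderiv ℝ g x :=
  (h.eventuallyEq_of_mem (hU.mem_nhds hx)).fderiv_eq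

/-- Differentiation along `v`, as an endomorphism of the analytic functions on `U`. -/
def dirDeriv {U : Set E3} (hU : IsOpen U) (v : E3) : Module.End ℂ (analyticOnSubmodule U) where
  toFun f := ⟨U.indicator fun x => fderiv ℝ f.1 x v,
    (f.2.1.fderiv_apply_const v).indicator_mem_analyticOnSubmodule hU⟩
  map_add' f g := by
    ext x
    by_cases hx : x ∈ U
    · have hf := (f.2.1 x hx).differentiableAt
      have hg := (g.2.1 x hx).differentiableAt
      simp [hx, fderiv_add hf hg]
    · simp [hx]
  map_smul' c f := by
    ext x
    by_cases hx : x ∈ U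
    · have hf := (f.2.1 x hx).differentiableAt
      simp [hx, fderiv_const_smul hf c]
    · simp [hx]

theorem dirDeriv_apply {U : Set E3} (hU : IsOpen U) (v : E3) (f : analyticOnSubmodule U)
    {x : E3} (hx : x ∈ U) : (dirDeriv hU v f).1 x = fderiv ℝ f.1 x v :=
  Set.indicator_of_mem hx fun x => fderiv ℝ f.1 x v

theorem dirDeriv_apply_of_notMem {U : Set E3} (hU : IsOpen U) (v : E3)
    (f : analyticOnSubmodule U) {x : E3} (hx : x ∉ U) : (dirDeriv hU v f).1 x = 0 :=
  Set.indicator_of_notMem hx fun x => fderiv ℝ f.1 x v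

theorem dirDeriv_commute {U : Set E3} (hU : IsOpen U) (v w : E3) :
    Commute (dirDeriv hU v) (dirDeriv hU w) := by
  have key (v w : E3) (f : analyticOnSubmodule U) {x : E3} (hx : x ∈ U) :
      (dirDeriv hU v (dirDeriv hU w f)).1 x = fderiv ℝ (fderiv ℝ f.1) x v w := by
    rw [dirDeriv_apply hU v _ hx,
      fderiv_eq_of_eqOn hU (fun y hy => dirDeriv_apply hU w f hy) hx,
      fderiv_clm_apply (f.2.1.fderiv x hx).differentiableAt (differentiableAt_const w)]
    simp
  refine LinearMap.ext fun f => Subtype.ext (funext fun x => ?_)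
  rw [Module.End.mul_apply, Module.End.mul_apply]
  by_cases hx : x ∈ U
  · rw [key v w f hx, key w v f hx]
    exact ((f.2.1 x hx).contDiffAt (n := ⊤)).isSymmSndFDerivAt (by simp) v w
  · rw [dirDeriv_apply_of_notMem hU _ _ hx, dirDeriv_apply_of_notMem hU _ _ hx]

theorem dirDeriv_pow_apply {U : Set E3} (hU : IsOpen U) (v : E3) (f : analyticOnSubmodule U)
    (n : ℕ) {x : E3} (hx : x ∈ U) :
    ((dirDeriv hU v ^ n) f).1 x = iteratedFDeriv ℝ n f.1 x fun _ => v := by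
  induction n generalizing x with
  | zero => simp
  | succ n ih =>
    rw [pow_succ', Module.End.mul_apply, dirDeriv_apply hU v _ hx,
      fderiv_eq_of_eqOn hU (fun y hy => ih hy) hx, iteratedFDeriv_succ_apply_left,
      fderiv_continuousMultilinear_apply_const_apply
        (f.2.1.iteratedFDeriv n x hx).differentiableAt]
    rfl

theorem dirDeriv_eq {U : Set E3} (hU : IsOpen U) (v : E3) :
    dirDeriv hU v = ((v 0 + I * v 1) / 2) •
        (dirDeriv hU (EuclideanSpace.single 0 1) - I • dirDeriv hU (EuclideanSpace.single 1 1)) +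
      ((v 0 - I * v 1) / 2) •
        (dirDeriv hU (EuclideanSpace.single 0 1) + I • dirDeriv hU (EuclideanSpace.single 1 1)) +
      (v 2 : ℂ) • dirDeriv hU (EuclideanSpace.single 2 1) := by
  have hv : v = v 0 • EuclideanSpace.single 0 1 + v 1 • EuclideanSpace.single 1 1 +
      v 2 • EuclideanSpace.single 2 1 := by
    ext i
    fin_cases i <;> simp
  have hsum : dirDeriv hU v = (v 0 : ℂ) • dirDeriv hU (EuclideanSpace.single 0 1) +
      (v 1 : ℂ) • dirDeriv hU (EuclideanSpace.single 1 1) +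
      (v 2 : ℂ) • dirDeriv hU (EuclideanSpace.single 2 1) := by
    refine LinearMap.ext fun f => Subtype.ext (funext fun x => ?_)
    by_cases hx : x ∈ U
    · simp only [LinearMap.add_apply, LinearMap.smul_apply, Submodule.coe_add,
        Submodule.coe_smul, Pi.add_apply, Pi.smul_apply, dirDeriv_apply hU _ f hx]
      conv_lhs => rw [hv]
      simp only [map_add, map_smul, Complex.real_smul, smul_eq_mul]
    · simp [dirDeriv_apply_of_notMem hU _ f hx]
  rw [hsum]
  match_scalars
  · ring
  · linear_combination (v 1 : ℂ) * I_sq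
  · ring

theorem trinomial_div_factorial {A : Type*} [Ring A] [Algebra ℂ A] {P Q R : A}
    (hPQ : Commute P Q) (hPR : Commute P R) (hQR : Commute Q R) (a b c : ℂ) (n : ℕ) :
    (n.factorial : ℂ)⁻¹ • (a • P + b • Q + c • R) ^ n =
      ∑ m ∈ range (n + 1), ∑ s ∈ range (m + 1),
        (a ^ s * b ^ (m - s) * c ^ (n - m) /
          (((n - m).factorial : ℂ) * (s.factorial : ℂ) * ((m - s).factorial : ℂ))) •
          (P ^ s * Q ^ (m - s) * R ^ (n - m)) := by
  have h1 : Commute (a • P) (b • Q) := (hPQ.smul_left a).smul_right b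
  have h2 : Commute (a • P + b • Q) (c • R) :=
    (((hPR.smul_left a).add_left (hQR.smul_left b)).smul_right c)
  rw [h2.add_pow, smul_sum]
  refine sum_congr rfl fun m hm => ?_
  rw [h1.add_pow, sum_mul, sum_mul, smul_sum]
  refine sum_congr rfl fun s hs => ?_
  have hm' : m ≤ n := by simpa [Nat.lt_succ_iff] using hm
  have hs' : s ≤ m := by simpa [Nat.lt_succ_iff] using hs
  rw [← nsmul_eq_mul', ← nsmul_eq_mul', ← Nat.cast_smul_eq_nsmul ℂ, ← Nat.cast_smul_eq_nsmul ℂ,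
    Nat.cast_choose ℂ hm', Nat.cast_choose ℂ hs']
  simp only [smul_pow, smul_mul_assoc, mul_smul_comm, smul_smul]
  congr 1
  have := Nat.cast_ne_zero (R := ℂ).2 n.factorial_ne_zero
  have := Nat.cast_ne_zero (R := ℂ).2 m.factorial_ne_zero
  field_simp

theorem Dop_eqOn {U : Set E3} (hU : IsOpen U) (f : E3 → ℂ) (g : analyticOnSubmodule U)
    (hfg : Set.EqOn f g.1 U) (n m s : ℕ) :
    Set.EqOn (Dop n m s f)
      (((dirDeriv hU (EuclideanSpace.single 0 1) -
            I • dirDeriv hU (EuclideanSpace.single 1 1)) ^ s *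
          (dirDeriv hU (EuclideanSpace.single 0 1) +
            I • dirDeriv hU (EuclideanSpace.single 1 1)) ^ (m - s) *
          dirDeriv hU (EuclideanSpace.single 2 1) ^ (n - m)) g).1 U := by
  have iter (D : (E3 → ℂ) → E3 → ℂ) (T : Module.End ℂ (analyticOnSubmodule U))
      (hDT : ∀ f (g : analyticOnSubmodule U), Set.EqOn f g.1 U → Set.EqOn (D f) (T g).1 U)
      (j : ℕ) (f : E3 → ℂ) (g : analyticOnSubmodule U) (h : Set.EqOn f g.1 U) :
      Set.EqOn (D^[j] f) ((T ^ j) g).1 U := by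
    induction j with
    | zero => simpa using h
    | succ j ih =>
      rw [Function.iterate_succ_apply', pow_succ', Module.End.mul_apply]
      exact hDT _ _ ih
  have hpd (i : Fin 3) (f : E3 → ℂ) (g : analyticOnSubmodule U) (h : Set.EqOn f g.1 U) :
      Set.EqOn (pd i f) (dirDeriv hU (EuclideanSpace.single i 1) g).1 U := fun x hx => by
    rw [dirDeriv_apply hU _ g hx, pd, fderiv_eq_of_eqOn hU h hx]
  refine iter Dminus _ (fun f g h x hx => ?_) s _ _
    (iter Dplus _ (fun f g h x hx => ?_) (m - s) _ _ (iter _ _ (hpd 2) (n - m) _ _ hfg))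
  · simp [Dminus, hpd 0 f g h hx, hpd 1 f g h hx]
  · simp [Dplus, hpd 0 f g h hx, hpd 1 f g h hx]

theorem inv_factorial_smul_iteratedFDeriv_eq_sum_Dop {U : Set E3} (hU : IsOpen U) (f : E3 → ℂ)
    (g : analyticOnSubmodule U) (hfg : Set.EqOn f g.1 U) (v : E3) (n : ℕ) {x : E3} (hx : x ∈ U) :
    (n.factorial : ℝ)⁻¹ • iteratedFDeriv ℝ n g.1 x (fun _ => v) =
      ∑ m ∈ range (n + 1), ∑ s ∈ range (m + 1), tAlpha n m s v * Dop n m s f x /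
        ((2 : ℂ) ^ m * ((n - m).factorial : ℂ) * (s.factorial : ℂ) *
          ((m - s).factorial : ℂ)) := by
  have hcomm := dirDeriv_commute hU
  let d (i : Fin 3) := dirDeriv hU (EuclideanSpace.single i 1)
  have hP (i : Fin 3) : Commute (d 0 - I • d 1) (d i) :=
    Commute.sub_left (R := Module.End ℂ (analyticOnSubmodule U)) (hcomm _ _)
      ((hcomm _ _).smul_left I)
  have hPQ : Commute (d 0 - I • d 1) (d 0 + I • d 1) := (hP 0).add_right ((hP 1).smul_right I)
  have hQR : Commute (d 0 + I • d 1) (d 2) := (hcomm _ _).add_left ((hcomm _ _).smul_left I)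
  have htri := congrArg (fun T : Module.End ℂ (analyticOnSubmodule U) => (T g).1 x)
    (trinomial_div_factorial (A := Module.End ℂ (analyticOnSubmodule U)) hPQ (hP 2) hQR
    ((v 0 + I * v 1) / 2) ((v 0 - I * v 1) / 2) (v 2 : ℂ) n)
  simp only [d, ← dirDeriv_eq, LinearMap.smul_apply, LinearMap.sum_apply, Submodule.coe_smul,
    Submodule.coe_sum, Pi.smul_apply, Finset.sum_apply, dirDeriv_pow_apply hU v g n hx,
    ← Dop_eqOn hU f g hfg _ _ _ hx] at htri
  rw [← Complex.coe_smul, ofReal_inv, ofReal_natCast, htri]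
  refine sum_congr rfl fun m _ => sum_congr rfl fun s hs => ?_
  have h2 : (2 : ℂ) ^ m = 2 ^ s * 2 ^ (m - s) := by
    rw [← pow_add, Nat.add_sub_cancel' (Nat.lt_succ_iff.1 (mem_range.1 hs))]
  rw [tAlpha, smul_eq_mul, h2, div_pow, div_pow]
  field_simp

theorem Hk_analyticOnNhd {k : ℂ} (hk : k ≠ 0) (r : E3) :
    AnalyticOnNhd ℝ (fun w => Hk k r w) {r}ᶜ := by
  intro w hw
  have hrw : r - w ≠ 0 := sub_ne_zero.2 (Ne.symm hw)
  have hnorm : AnalyticAt ℝ (fun w : E3 => ‖r - w‖) w :=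
    ((contDiffAt_norm (n := ⊤) ℝ hrw).comp w (contDiffAt_const.sub contDiffAt_id)).analyticAt
  have hlin : AnalyticAt ℝ (fun w : E3 => I * (k * (‖r - w‖ : ℝ))) w :=
    analyticAt_const.mul (analyticAt_const.mul ((ofRealCLM.analyticAt _).comp hnorm))
  have hexp : AnalyticAt ℝ (fun w : E3 => Complex.exp (I * (k * (‖r - w‖ : ℝ)))) w :=
    (analyticAt_cexp.restrictScalars (𝕜 := ℝ)).comp hlin
  exact hexp.div hlin (by simp [hk, hrw])

/-- Taylor expansion of h₀⁽¹⁾(k‖r − r'‖) in the source variable r' at the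
origin, with symmetric mixed derivatives 𝒟̂ₙₘˢ taken in the source variable and evaluated
at r' = 0; the expansion converges absolutely for ‖r'‖ small enough. -/
theorem statement0 (k : ℂ) (hk : k ≠ 0) (r : E3) (hr : r ≠ 0) :
    ∃ a : ℝ, 0 < a ∧ ∀ r' : E3, ‖r'‖ ≤ a →
      Summable (fun n : ℕ => ‖∑ m ∈ Finset.range (n + 1), ∑ s ∈ Finset.range (m + 1),
        tAlpha n m s r' * Dop n m s (fun w => Hk k r w) 0 /
          ((2 : ℂ) ^ m * ((n - m).factorial : ℂ) * (s.factorial : ℂ) *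
            ((m - s).factorial : ℂ))‖) ∧
      HasSum (fun n : ℕ => ∑ m ∈ Finset.range (n + 1), ∑ s ∈ Finset.range (m + 1),
        tAlpha n m s r' * Dop n m s (fun w => Hk k r w) 0 /
          ((2 : ℂ) ^ m * ((n - m).factorial : ℂ) * (s.factorial : ℂ) *
            ((m - s).factorial : ℂ)))
        (Hk k r r') := by
  have hU : IsOpen ({r}ᶜ : Set E3) := isOpen_compl_singleton
  have hmem0 : (0 : E3) ∈ ({r}ᶜ : Set E3) := Ne.symm hr
  let g : analyticOnSubmodule ({r}ᶜ : Set E3) :=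
    ⟨_, (Hk_analyticOnNhd hk r).indicator_mem_analyticOnSubmodule hU⟩
  have hg : Set.EqOn (fun w => Hk k r w) g.1 {r}ᶜ := fun x hx =>
    (Set.indicator_of_mem hx _).symm
  obtain ⟨p, R, hp⟩ := g.2.1 0 hmem0
  obtain ⟨a, ha0, haR⟩ := ENNReal.lt_iff_exists_nnreal_btwn.1
    (lt_min hp.r_pos (ENNReal.ofReal_pos.2 (norm_pos_iff.2 hr)))
  refine ⟨a, by simpa using ha0, fun r' hr' => ?_⟩
  rw [summable_norm_iff, and_iff_right_of_imp HasSum.summable]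
  have har : (a : ℝ) < ‖r‖ := by
    have := haR.trans_le (min_le_right _ _)
    rwa [← ENNReal.ofReal_coe_nnreal, ENNReal.ofReal_lt_ofReal_iff (norm_pos_iff.2 hr)] at this
  have hmem : r' ∈ ({r}ᶜ : Set E3) := fun h => (hr'.trans_lt har).ne (congrArg norm h)
  have hball : r' ∈ Metric.eball (0 : E3) R := by
    rw [mem_eball_zero_iff]
    refine lt_of_le_of_lt ?_ (haR.trans_le (min_le_left _ _))
    rw [enorm_le_coe]
    exact_mod_cast hr'
  have hsum := hp.hasSum_iteratedFDeriv hball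
  rw [zero_add, ← hg hmem] at hsum
  convert hsum using 1
  funext n
  exact (inv_factorial_smul_iteratedFDeriv_eq_sum_Dop hU _ g hg r' n hmem0).symm

end
end

section
/- Let k ∈ ℂ with k ≠ 0 and let r' ∈ ℝ³ with r' ≠ 0. Then there exists a radius a > 0 such that for every r ∈ ℝ³ with ‖r‖ ≤ a one has the absolutely convergent expansion h₀⁽¹⁾(k‖r − r'‖) = Σ_{n=0}^∞ Σ_{m=0}^{n} Σ_{s=0}^{m} βₙₘˢ · α̃ₙₘˢ(r), where βₙₘˢ = (𝒟ₙₘˢ H_k)(0, r') / (2^m (n−m)! s! (m−s)!) and (𝒟ₙₘˢ H_k)(0, r') denotes the indicated mixed partial derivative of H_k with respect to the target variable r, evaluated at r = 0. -/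
open Complex Finset

noncomputable section

open scoped ContDiff Nat Topology

/-- The smooth complex-valued functions on Euclidean 3-space. -/
def smoothFunctions : Submodule ℂ (E3 → ℂ) where
  carrier := {f | ContDiff ℝ ∞ f}
  add_mem' := by
    intro f g (hf : ContDiff ℝ ∞ f) (hg : ContDiff ℝ ∞ g)
    exact hf.add hg
  zero_mem' := (contDiff_const : ContDiff ℝ ∞ fun _ : E3 => (0 : ℂ))
  smul_mem' := by
    intro c f (hf : ContDiff ℝ ∞ f)
    exact hf.const_smul c

theorem contDiff_coe (f : smoothFunctions) : ContDiff ℝ ∞ (f : E3 → ℂ) := f.2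

theorem differentiableAt_coe (f : smoothFunctions) (w : E3) :
    DifferentiableAt ℝ (f : E3 → ℂ) w :=
  ((contDiff_coe f).differentiable (by simp)).differentiableAt

/-- The directional derivative along `v`, as an operator on smooth functions. -/
def directionalDeriv (v : E3) : Module.End ℂ smoothFunctions where
  toFun f := ⟨fun w => fderiv ℝ (f : E3 → ℂ) w v,
    ((contDiff_coe f).fderiv_right (m := ∞) (by simp)).clm_apply contDiff_const⟩
  map_add' f g := by
    ext w
    simp [fderiv_add (differentiableAt_coe f w) (differentiableAt_coe g w)]
  map_smul' c f := by
    ext w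
    simp [fderiv_const_smul (differentiableAt_coe f w) c]

theorem directionalDeriv_apply (v : E3) (f : smoothFunctions) (w : E3) :
    (directionalDeriv v f : E3 → ℂ) w = fderiv ℝ (f : E3 → ℂ) w v := rfl

theorem directionalDeriv_commute (u v : E3) :
    Commute (directionalDeriv u) (directionalDeriv v) := by
  refine LinearMap.ext fun f => Subtype.ext (funext fun w => ?_)
  have hd : DifferentiableAt ℝ (fderiv ℝ (f : E3 → ℂ)) w :=
    (((contDiff_coe f).fderiv_right (m := ∞) (by simp)).differentiable (by simp)).differentiableAt
  have key (a b : E3) : fderiv ℝ (fun x => fderiv ℝ (f : E3 → ℂ) x a) w b =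
      fderiv ℝ (fderiv ℝ (f : E3 → ℂ)) w b a := by
    rw [fderiv_clm_apply hd (differentiableAt_const a)]
    simp
  change fderiv ℝ (fun x => fderiv ℝ (f : E3 → ℂ) x v) w u =
    fderiv ℝ (fun x => fderiv ℝ (f : E3 → ℂ) x u) w v
  rw [key, key]
  exact ((contDiff_coe f).contDiffAt.isSymmSndFDerivAt
    (by simpa using WithTop.coe_le_coe.mpr (le_top : (2 : ℕ∞) ≤ ⊤))).eq u v

theorem directionalDeriv_pow_apply (v : E3) (n : ℕ) (f : smoothFunctions) (w : E3) :
    ((directionalDeriv v ^ n) f : E3 → ℂ) w = iteratedFDeriv ℝ n (f : E3 → ℂ) w fun _ => v := by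
  induction n generalizing f with
  | zero => simp
  | succ n ih =>
    rw [pow_succ, Module.End.mul_apply, ih, iteratedFDeriv_succ_apply_right]
    have h : (directionalDeriv v f : E3 → ℂ) =
        ContinuousLinearMap.apply ℝ ℂ v ∘ fderiv ℝ (f : E3 → ℂ) := rfl
    rw [h, ContinuousLinearMap.iteratedFDeriv_comp_left (n := ∞) _
      ((contDiff_coe f).fderiv_right (m := ∞) (by simp)).contDiffAt (by exact_mod_cast le_top)]
    rfl

theorem directionalDeriv_add (u v : E3) :
    directionalDeriv (u + v) = directionalDeriv u + directionalDeriv v :=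
  LinearMap.ext fun f => Subtype.ext (funext fun w => map_add (fderiv ℝ (f : E3 → ℂ) w) u v)

theorem directionalDeriv_smul (c : ℝ) (v : E3) :
    directionalDeriv (c • v) = (c : ℂ) • directionalDeriv v :=
  LinearMap.ext fun f => Subtype.ext (funext fun w => by
    simp [directionalDeriv_apply])

/-- The partial derivative along the `i`-th coordinate on smooth functions. -/
def partialEnd (i : Fin 3) : Module.End ℂ smoothFunctions :=
  directionalDeriv (EuclideanSpace.single i 1)

/-- The operator `∂/∂x + i ∂/∂y` on smooth functions. -/
def plusEnd : Module.End ℂ smoothFunctions := partialEnd 0 + I • partialEnd 1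

/-- The operator `∂/∂x − i ∂/∂y` on smooth functions. -/
def minusEnd : Module.End ℂ smoothFunctions := partialEnd 0 - I • partialEnd 1

theorem partialEnd_eq (i : Fin 3) :
    partialEnd i = directionalDeriv (EuclideanSpace.single i 1) := rfl

theorem partialEnd_commute (i j : Fin 3) : Commute (partialEnd i) (partialEnd j) :=
  directionalDeriv_commute _ _

theorem minusEnd_commute_plusEnd : Commute minusEnd plusEnd := by
  have h (i j : Fin 3) := partialEnd_commute i j
  exact (Commute.sub_left (R := Module.End ℂ smoothFunctions)
    ((h 0 0).add_right ((h 0 1).smul_right I))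
    (((h 1 0).add_right ((h 1 1).smul_right I)).smul_left I))

theorem minusEnd_commute_partialEnd (i : Fin 3) : Commute minusEnd (partialEnd i) :=
  Commute.sub_left (R := Module.End ℂ smoothFunctions) (partialEnd_commute 0 i)
    ((partialEnd_commute 1 i).smul_left I)

theorem plusEnd_commute_partialEnd (i : Fin 3) : Commute plusEnd (partialEnd i) :=
  (partialEnd_commute 0 i).add_left ((partialEnd_commute 1 i).smul_left I)

theorem coe_pow_apply_eq_iterate {T : Module.End ℂ smoothFunctions} {t : (E3 → ℂ) → E3 → ℂ}
    (h : ∀ f : smoothFunctions, (T f : E3 → ℂ) = t f) (n : ℕ) (f : smoothFunctions) :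
    ((T ^ n) f : E3 → ℂ) = t^[n] f := by
  induction n with
  | zero => rfl
  | succ n ih => rw [pow_succ', Module.End.mul_apply, h, ih, Function.iterate_succ_apply']

theorem Dop_eq_end_apply (n m s : ℕ) (f : smoothFunctions) :
    Dop n m s f = ((minusEnd ^ s * (plusEnd ^ (m - s) * partialEnd 2 ^ (n - m))) f : E3 → ℂ) := by
  rw [Module.End.mul_apply, Module.End.mul_apply,
    coe_pow_apply_eq_iterate (t := Dminus) (fun _ => rfl),
    coe_pow_apply_eq_iterate (t := Dplus) (fun _ => rfl),
    coe_pow_apply_eq_iterate (t := pd 2) (fun _ => rfl)]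
  rfl

theorem directionalDeriv_eq_minusEnd_plusEnd (r : E3) :
    directionalDeriv r = (((r 0 : ℂ) + I * r 1) / 2) • minusEnd +
      (((r 0 : ℂ) - I * r 1) / 2) • plusEnd + (r 2 : ℂ) • partialEnd 2 := by
  have hr : r = r 0 • EuclideanSpace.single 0 (1 : ℝ) + r 1 • EuclideanSpace.single 1 (1 : ℝ) +
      r 2 • EuclideanSpace.single 2 (1 : ℝ) := by
    ext i
    fin_cases i <;> simp
  conv_lhs => rw [hr]
  simp only [directionalDeriv_add, directionalDeriv_smul, minusEnd, plusEnd, ← partialEnd_eq]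
  match_scalars
  · ring
  · linear_combination (r 1 : ℂ) * I_sq
  · ring

theorem directionalDeriv_pow (r : E3) (n : ℕ) :
    (n ! : ℂ)⁻¹ • directionalDeriv r ^ n =
      ∑ m ∈ range (n + 1), ∑ s ∈ range (m + 1),
        (tAlpha n m s r / ((2 : ℂ) ^ m * ((n - m)! : ℂ) * (s ! : ℂ) * ((m - s)! : ℂ))) •
          (minusEnd ^ s * (plusEnd ^ (m - s) * partialEnd 2 ^ (n - m))) := by
  have hMP (a b : ℂ) : Commute (a • minusEnd) (b • plusEnd) :=
    (minusEnd_commute_plusEnd.smul_left a).smul_right b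
  have hZ (a b c : ℂ) : Commute (a • minusEnd + b • plusEnd) (c • partialEnd 2) :=
    (((minusEnd_commute_partialEnd 2).smul_left a).add_left
      ((plusEnd_commute_partialEnd 2).smul_left b)).smul_right c
  rw [directionalDeriv_eq_minusEnd_plusEnd, (hZ _ _ _).add_pow, smul_sum]
  refine sum_congr rfl fun m hm => ?_
  rw [(hMP _ _).add_pow, sum_mul, sum_mul, smul_sum]
  refine sum_congr rfl fun s hs => ?_
  have hmn : m ≤ n := Nat.lt_succ_iff.mp (mem_range.mp hm)
  have hsm : s ≤ m := Nat.lt_succ_iff.mp (mem_range.mp hs)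
  simp only [smul_pow, ← nsmul_eq_mul', ← Nat.cast_smul_eq_nsmul ℂ, smul_mul_assoc,
    mul_smul_comm, smul_smul, mul_assoc]
  congr 1
  have h2 : (2 : ℂ) ^ m = 2 ^ s * 2 ^ (m - s) := by rw [← pow_add, Nat.add_sub_cancel' hsm]
  have hf (j : ℕ) : (j ! : ℂ) ≠ 0 := Nat.cast_ne_zero.mpr j.factorial_ne_zero
  rw [Nat.cast_choose ℂ hmn, Nat.cast_choose ℂ hsm, h2, tAlpha, div_pow, div_pow]
  simp only [smul_eq_mul]
  field_simp [hf]

theorem Filter.EventuallyEq.pd {f g : E3 → ℂ} {x : E3} (h : f =ᶠ[𝓝 x] g) (i : Fin 3) :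
    pd i f =ᶠ[𝓝 x] pd i g :=
  h.fderiv.mono fun _ hw => congrArg (fun L : E3 →L[ℝ] ℂ => L (EuclideanSpace.single i 1)) hw

theorem Filter.EventuallyEq.Dplus {f g : E3 → ℂ} {x : E3} (h : f =ᶠ[𝓝 x] g) :
    Dplus f =ᶠ[𝓝 x] Dplus g :=
  (h.pd 0).add ((h.pd 1).const_smul I)

theorem Filter.EventuallyEq.Dminus {f g : E3 → ℂ} {x : E3} (h : f =ᶠ[𝓝 x] g) :
    Dminus f =ᶠ[𝓝 x] Dminus g :=
  (h.pd 0).sub ((h.pd 1).const_smul I)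

theorem Filter.EventuallyEq.iterate_operator {t : (E3 → ℂ) → E3 → ℂ} {x : E3}
    (ht : ∀ f g : E3 → ℂ, f =ᶠ[𝓝 x] g → t f =ᶠ[𝓝 x] t g) {f g : E3 → ℂ}
    (h : f =ᶠ[𝓝 x] g) (n : ℕ) : t^[n] f =ᶠ[𝓝 x] t^[n] g := by
  induction n with
  | zero => exact h
  | succ n ih =>
    rw [Function.iterate_succ_apply', Function.iterate_succ_apply']
    exact ht _ _ ih

theorem Filter.EventuallyEq.Dop {f g : E3 → ℂ} {x : E3} (h : f =ᶠ[𝓝 x] g) (n m s : ℕ) :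
    Dop n m s f =ᶠ[𝓝 x] Dop n m s g :=
  iterate_operator (fun _ _ h => h.Dminus)
    (iterate_operator (fun _ _ h => h.Dplus) (iterate_operator (fun _ _ h => h.pd 2) h _) _) _

theorem AnalyticAt.exists_smoothFunctions_eventuallyEq {f : E3 → ℂ} {x : E3}
    (hf : AnalyticAt ℝ f x) : ∃ g : smoothFunctions, f =ᶠ[𝓝 x] g := by
  obtain ⟨ε, hε, hball⟩ := Metric.eventually_nhds_iff_ball.mp hf.eventually_analyticAt
  let b : ContDiffBump x := ⟨ε / 4, ε / 2, by positivity, by linarith⟩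
  have hsmooth : ContDiff ℝ ∞ fun w => b w • f w := by
    refine contMDiff_iff_contDiff.mp (contMDiff_of_tsupport fun w hw => ?_)
    have hw' := closure_mono (Function.support_smul_subset_left b f) hw
    rw [← tsupport, b.tsupport_eq, Metric.mem_closedBall] at hw'
    have hwε : dist w x < ε := hw'.trans_lt (half_lt_self hε)
    exact (b.contDiffAt.smul (hball w hwε).contDiffAt).contMDiffAt
  refine ⟨⟨_, hsmooth⟩, ?_⟩
  filter_upwards [b.eventuallyEq_one] with w hw
  simp [hw]

theorem AnalyticAt.iteratedFDeriv_eq_sum_Dop {f : E3 → ℂ} (hf : AnalyticAt ℝ f 0)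
    (n : ℕ) (r : E3) :
    (n ! : ℝ)⁻¹ • iteratedFDeriv ℝ n f 0 (fun _ => r) =
      ∑ m ∈ range (n + 1), ∑ s ∈ range (m + 1),
        (Dop n m s f 0 / ((2 : ℂ) ^ m * ((n - m)! : ℂ) * (s ! : ℂ) * ((m - s)! : ℂ))) *
          tAlpha n m s r := by
  obtain ⟨g, hg⟩ := hf.exists_smoothFunctions_eventuallyEq
  have h := congrArg (fun T : Module.End ℂ smoothFunctions => (T g : E3 → ℂ) 0)
    (directionalDeriv_pow r n)
  simp only [LinearMap.smul_apply, LinearMap.sum_apply, Submodule.coe_smul, Submodule.coe_sum,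
    Finset.sum_apply, Pi.smul_apply, ← Dop_eq_end_apply, directionalDeriv_pow_apply,
    ← (hg.Dop _ _ _).eq_of_nhds, ← (hg.iteratedFDeriv ℝ n).eq_of_nhds, smul_eq_mul] at h
  rw [Complex.real_smul]
  push_cast
  rw [h]
  exact sum_congr rfl fun m _ => sum_congr rfl fun s _ => by ring

theorem analyticAt_Hk {k : ℂ} (hk : k ≠ 0) {r r' : E3} (h : r ≠ r') :
    AnalyticAt ℝ (fun w => Hk k w r') r := by
  have hne : r - r' ≠ 0 := sub_ne_zero.mpr h
  have hnorm : ContDiffAt ℝ ω (fun w : E3 => ‖w - r'‖) r :=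
    (contDiffAt_id.sub contDiffAt_const).norm ℝ hne
  have harg : ContDiffAt ℝ ω (fun w : E3 => I * (k * (‖w - r'‖ : ℂ))) r :=
    contDiffAt_const.mul (contDiffAt_const.mul (ofRealCLM.contDiff.contDiffAt.comp r hnorm))
  have hz : I * (k * (‖r - r'‖ : ℂ)) ≠ 0 := by simp [hk, hne]
  exact harg.cexp.analyticAt.div harg.analyticAt hz

/-- Taylor expansion of h₀⁽¹⁾(k‖r − r'‖) in the target variable r at the
origin, with coefficients βₙₘˢ given by the mixed derivatives 𝒟ₙₘˢ taken in the target
variable and evaluated at r = 0; the expansion converges absolutely for ‖r‖ small enough. -/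
theorem statement1 (k : ℂ) (hk : k ≠ 0) (r' : E3) (hr' : r' ≠ 0) :
    ∃ a : ℝ, 0 < a ∧ ∀ r : E3, ‖r‖ ≤ a →
      Summable (fun n : ℕ => ‖∑ m ∈ Finset.range (n + 1), ∑ s ∈ Finset.range (m + 1),
        (Dop n m s (fun w => Hk k w r') 0 /
          ((2 : ℂ) ^ m * ((n - m).factorial : ℂ) * (s.factorial : ℂ) *
            ((m - s).factorial : ℂ))) * tAlpha n m s r‖) ∧
      HasSum (fun n : ℕ => ∑ m ∈ Finset.range (n + 1), ∑ s ∈ Finset.range (m + 1),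
        (Dop n m s (fun w => Hk k w r') 0 /
          ((2 : ℂ) ^ m * ((n - m).factorial : ℂ) * (s.factorial : ℂ) *
            ((m - s).factorial : ℂ))) * tAlpha n m s r)
        (Hk k r r') := by
  have hf : AnalyticAt ℝ (fun w => Hk k w r') 0 := analyticAt_Hk hk hr'.symm
  obtain ⟨p, R, hp⟩ := id hf
  obtain ⟨a, ha, haR⟩ := ENNReal.lt_iff_exists_nnreal_btwn.mp hp.r_pos
  refine ⟨a, by exact_mod_cast ha, fun r hr => ?_⟩
  have hmem : r ∈ Metric.eball (0 : E3) R := by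
    rw [mem_eball_zero_iff]
    refine lt_of_le_of_lt ?_ haR
    exact_mod_cast hr
  have hsum := hp.hasSum_iteratedFDeriv hmem
  have hnorm := p.summable_norm_apply (Metric.eball_subset_eball hp.r_le hmem)
  have hterm (n : ℕ) : p n (fun _ => r) =
      (n ! : ℝ)⁻¹ • iteratedFDeriv ℝ n (fun w => Hk k w r') 0 fun _ => r := by
    rw [← hp.factorial_smul r n, ← Nat.cast_smul_eq_nsmul ℝ, smul_smul,
      inv_mul_cancel₀ (Nat.cast_ne_zero.mpr n.factorial_ne_zero), one_smul]
  simp only [hterm, hf.iteratedFDeriv_eq_sum_Dop] at hsum hnorm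
  rw [zero_add] at hsum
  exact ⟨hnorm, hsum⟩

end
end

section
/- Fix k ∈ ℂ and an integer m ≥ 0. Then for all (x, y) ∈ ℝ², the m-th iterate of the operator ∂/∂x + i ∂/∂y applied to the function Ψ₀ (i.e. (x, y) ↦ J₀(k√(x² + y²))) satisfies ((∂ₓ + i∂_y)^m Ψ₀)(x, y) = (−k)^m Ψₘ(x, y); in polar coordinates this reads (∂ₓ + i∂_y)^m J₀(kr) = (−k)^m Jₘ(kr) e^{imθ}. -/
open Complex

noncomputable section

/-- Partial derivative ∂/∂x of a complex-valued function on ℝ². -/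
noncomputable def pdx (f : ℝ × ℝ → ℂ) : ℝ × ℝ → ℂ := fun p => fderiv ℝ f p (1, 0)

/-- Partial derivative ∂/∂y of a complex-valued function on ℝ². -/
noncomputable def pdy (f : ℝ × ℝ → ℂ) : ℝ × ℝ → ℂ := fun p => fderiv ℝ f p (0, 1)

/-- The operator ∂/∂x + i ∂/∂y on ℝ². -/
noncomputable def Dplus2 (f : ℝ × ℝ → ℂ) : ℝ × ℝ → ℂ := fun p => pdx f p + I * pdy f p

/-- The function Ψₙ(x, y); in polar coordinates x + iy = r e^{iθ} it equals Jₙ(kr) e^{inθ},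
where Jₙ is the Bessel function of the first kind of integer order n
(with J₋ₙ = (−1)ⁿ Jₙ for negative orders). -/
noncomputable def Psi (k : ℂ) (n : ℤ) (p : ℝ × ℝ) : ℂ :=
  if 0 ≤ n then
    ((p.1 : ℂ) + I * (p.2 : ℂ)) ^ n.toNat * (k / 2) ^ n.toNat *
      ∑' j : ℕ, ((-1 : ℂ) ^ j * (k / 2) ^ (2 * j) * ((p.1 : ℂ) ^ 2 + (p.2 : ℂ) ^ 2) ^ j) /
        ((j.factorial : ℂ) * ((j + n.toNat).factorial : ℂ))
  else
    (-1 : ℂ) ^ (-n).toNat * ((p.1 : ℂ) - I * (p.2 : ℂ)) ^ (-n).toNat * (k / 2) ^ (-n).toNat *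
      ∑' j : ℕ, ((-1 : ℂ) ^ j * (k / 2) ^ (2 * j) * ((p.1 : ℂ) ^ 2 + (p.2 : ℂ) ^ 2) ^ j) /
        ((j.factorial : ℂ) * ((j + (-n).toNat).factorial : ℂ))

/-- The entire function with `J_n(w) = (w / 2) ^ n * besselAux n ((w / 2) ^ 2)`. -/
noncomputable def besselAux (n : ℕ) (z : ℂ) : ℂ :=
  ∑' j : ℕ, (-1 : ℂ) ^ j * z ^ j / ((j.factorial : ℂ) * ((j + n).factorial : ℂ))

theorem hasDerivAt_besselAux (n : ℕ) (z : ℂ) :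
    HasDerivAt (besselAux n) (-besselAux (n + 1) z) z := by
  set R : ℝ := ‖z‖ + 1
  have hR : 0 < R := by positivity
  let g' : ℕ → ℂ → ℂ := fun j w =>
    (-1 : ℂ) ^ j * (j * w ^ (j - 1)) / ((j.factorial : ℂ) * ((j + n).factorial : ℂ))
  have hu : Summable fun j : ℕ => (j : ℝ) * R ^ (j - 1) / (j.factorial : ℝ) := by
    rw [← summable_nat_add_iff 1]
    refine (Real.summable_pow_div_factorial R).congr fun j => ?_
    rw [Nat.factorial_succ, Nat.add_sub_cancel]
    push_cast
    field_simp
  have hbound : ∀ (j : ℕ) (w : ℂ), w ∈ Metric.ball (0 : ℂ) R →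
      ‖g' j w‖ ≤ (j : ℝ) * R ^ (j - 1) / (j.factorial : ℝ) := by
    intro j w hw
    have hw' : ‖w‖ ≤ R := (mem_ball_zero_iff.mp hw).le
    have h1 : (1 : ℝ) ≤ ((j + n).factorial : ℝ) := by exact_mod_cast (j + n).factorial_pos
    have h2 : (0 : ℝ) < (j.factorial : ℝ) := by exact_mod_cast j.factorial_pos
    simp only [g', norm_div, norm_mul, norm_pow, norm_neg, norm_one, one_pow, one_mul,
      Complex.norm_natCast]
    gcongr
    exact le_mul_of_one_le_right h2.le h1
  have hz : z ∈ Metric.ball (0 : ℂ) R := by simp [R]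
  have hderiv := hasDerivAt_tsum_of_isPreconnected (y₀ := 0) (y := z)
    (g := fun j w => (-1 : ℂ) ^ j * w ^ j / ((j.factorial : ℂ) * ((j + n).factorial : ℂ)))
    (g' := g') hu Metric.isOpen_ball (convex_ball (0 : ℂ) R).isPreconnected
    (fun j w _ => ((hasDerivAt_pow j w).const_mul _).div_const _) hbound
    (Metric.mem_ball_self hR)
    (summable_of_ne_finset_zero (s := {0}) fun j hj => by
      simp [Finset.mem_singleton.not.mp hj]) hz
  have hsum : Summable fun j => g' j z :=
    Summable.of_norm_bounded hu fun j => hbound j z hz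
  refine HasDerivAt.congr_deriv hderiv ?_
  rw [hsum.tsum_eq_zero_add, besselAux, ← tsum_neg]
  simp only [g', Nat.cast_zero, zero_mul, mul_zero, zero_div, zero_add]
  refine tsum_congr fun j => ?_
  rw [Nat.factorial_succ, Nat.add_sub_cancel, add_right_comm j 1 n, ← add_assoc]
  have h1 : ((j + n + 1).factorial : ℂ) ≠ 0 := by exact_mod_cast Nat.factorial_ne_zero _
  have h2 : (j.factorial : ℂ) ≠ 0 := by exact_mod_cast Nat.factorial_ne_zero _
  have h3 : (j : ℂ) + 1 ≠ 0 := by exact_mod_cast j.succ_ne_zero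
  push_cast
  field_simp
  ring

theorem Psi_natCast (k : ℂ) (n : ℕ) (p : ℝ × ℝ) :
    Psi k n p = ((p.1 : ℂ) + I * p.2) ^ n * (k / 2) ^ n *
      besselAux n ((k / 2) ^ 2 * ((p.1 : ℂ) ^ 2 + (p.2 : ℂ) ^ 2)) := by
  simp only [Psi, Nat.cast_nonneg, if_true, Int.toNat_natCast, besselAux, mul_pow, pow_mul,
    mul_assoc]

theorem Dplus2_const_mul_Psi (c k : ℂ) (n : ℕ) :
    Dplus2 (fun p => c * Psi k n p) = fun p => c * (-k * Psi k (n + 1 : ℕ) p) := by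
  funext p
  have hx : HasFDerivAt (fun p : ℝ × ℝ => (p.1 : ℂ))
      (ofRealCLM.comp (ContinuousLinearMap.fst ℝ ℝ ℝ)) p :=
    (ofRealCLM.comp (ContinuousLinearMap.fst ℝ ℝ ℝ)).hasFDerivAt
  have hy : HasFDerivAt (fun p : ℝ × ℝ => (p.2 : ℂ))
      (ofRealCLM.comp (ContinuousLinearMap.snd ℝ ℝ ℝ)) p :=
    (ofRealCLM.comp (ContinuousLinearMap.snd ℝ ℝ ℝ)).hasFDerivAt
  have hB := (hasDerivAt_besselAux n ((k / 2) ^ 2 * ((p.1 : ℂ) ^ 2 + (p.2 : ℂ) ^ 2))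
    ).comp_hasFDerivAt p (((hx.pow 2).add (hy.pow 2)).const_mul ((k / 2) ^ 2))
  have hf := (((((hx.add (hy.const_mul I)).pow n).mul_const ((k / 2) ^ n)).mul hB).const_mul c)
  have hfd := (hf.congr_of_eventuallyEq (f₁ := fun p => c * Psi k n p)
    (.of_forall fun q => by simp [Psi_natCast])).fderiv
  simp only [Dplus2, pdx, pdy, hfd]
  simp only [Psi_natCast]
  simp
  generalize (k / 2) ^ 2 * ((p.1 : ℂ) ^ 2 + (p.2 : ℂ) ^ 2) = z
  ring_nf
  simp

theorem iterate_Dplus2_Psi_zero (k : ℂ) (m : ℕ) :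
    Dplus2^[m] (Psi k 0) = fun p => (-k) ^ m * Psi k m p := by
  induction m with
  | zero => simp
  | succ m ih =>
    rw [Function.iterate_succ_apply', ih, Dplus2_const_mul_Psi]
    funext p
    rw [pow_succ, mul_assoc]

/-- the m-th iterate of ∂/∂x + i ∂/∂y applied to Ψ₀, i.e. to
(x, y) ↦ J₀(k√(x² + y²)), equals (−k)^m Ψₘ; in polar coordinates,
(∂ₓ + i∂_y)^m J₀(kr) = (−k)^m Jₘ(kr) e^{imθ}. -/
theorem statement5 (k : ℂ) (m : ℕ) (x y : ℝ) :
    (Dplus2^[m] (Psi k 0)) (x, y) = (-k) ^ m * Psi k (m : ℤ) (x, y) := by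
  rw [iterate_Dplus2_Psi_zero]

end
end

section
/- Sommerfeld identity: let k ∈ ℂ with Re k > 0 and Im k > 0, and let r = (x, y, z) ∈ ℝ³ with z ≠ 0; set ρ = √(x² + y²). For each t ∈ [0, ∞), since Im(k² − t²) = 2 Re(k) Im(k) > 0, there is a unique complex square root k_z(t) of k² − t² with Im k_z(t) > 0. Then the improper integral ∫₀^∞ t J₀(tρ) e^{i k_z(t)|z|} / k_z(t) dt converges absolutely and h₀⁽¹⁾(k‖r‖) = (1/k) ∫₀^∞ t J₀(tρ) e^{i k_z(t)|z|} / k_z(t) dt. -/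
open Complex MeasureTheory

noncomputable section

/-- Bessel function of the first kind of order zero, via its everywhere-convergent
power series J₀(w) = Σ_{j=0}^∞ ((−1)^j/(j!)²) (w/2)^{2j}. -/
noncomputable def J0 (w : ℂ) : ℂ :=
  ∑' j : ℕ, ((-1 : ℂ) ^ j / ((j.factorial : ℂ)) ^ 2) * (w / 2) ^ (2 * j)

/-- The angular integral representing the Bessel function `J₀` on the real line. -/
def besselInt (x : ℝ) : ℝ := (1 / Real.pi) * ∫ θ in (0 : ℝ)..Real.pi, Real.cos (x * Real.sin θ)

theorem continuous_besselInt : Continuous besselInt := by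
  unfold besselInt
  refine continuous_const.mul
    (intervalIntegral.continuous_parametric_intervalIntegral_of_continuous' ?_ _ _)
  simp only [Function.uncurry_def]
  fun_prop

theorem abs_besselInt_le_one (x : ℝ) : |besselInt x| ≤ 1 := by
  have h := intervalIntegral.norm_integral_le_of_norm_le_const (a := 0) (b := Real.pi) (C := 1)
    (f := fun θ => Real.cos (x * Real.sin θ)) (fun θ _ => Real.abs_cos_le_one _)
  rw [Real.norm_eq_abs, sub_zero, abs_of_pos Real.pi_pos, one_mul] at h
  rw [besselInt, abs_mul, abs_of_pos (by positivity)]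
  calc _ ≤ 1 / Real.pi * Real.pi := by gcongr
    _ = 1 := by field_simp

theorem prod_odd_div_even (n : ℕ) :
    ∏ i ∈ Finset.range n, (2 * (i : ℝ) + 1) / (2 * i + 2) =
      ((2 * n).factorial : ℝ) / (4 ^ n * (n.factorial : ℝ) ^ 2) := by
  induction n with
  | zero => simp
  | succ n ih =>
    rw [Finset.prod_range_succ, ih, show 2 * (n + 1) = (2 * n + 1) + 1 by ring,
      Nat.factorial_succ, Nat.factorial_succ, Nat.factorial_succ]
    push_cast
    field_simp
    ring

theorem hasSum_besselInt (x : ℝ) :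
    HasSum (fun n : ℕ => (-1 : ℝ) ^ n / (n.factorial : ℝ) ^ 2 * (x / 2) ^ (2 * n))
      (besselInt x) := by
  have h := intervalIntegral.hasSum_integral_of_dominated_convergence
    (μ := volume) (a := 0) (b := Real.pi)
    (F := fun (n : ℕ) θ => (-1 : ℝ) ^ n * (x * Real.sin θ) ^ (2 * n) / ((2 * n).factorial : ℝ))
    (f := fun θ => Real.cos (x * Real.sin θ))
    (fun n _ => |x| ^ (2 * n) / ((2 * n).factorial : ℝ))
    (fun n => by
      refine Continuous.aestronglyMeasurable ?_
      fun_prop)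
    (fun n => Filter.Eventually.of_forall fun θ _ => by
      rw [norm_div, norm_mul, norm_pow, norm_neg, norm_one, one_pow, one_mul, norm_pow, norm_mul,
        Real.norm_eq_abs, Real.norm_eq_abs, RCLike.norm_natCast]
      gcongr
      exact mul_le_of_le_one_right (abs_nonneg _) (Real.abs_sin_le_one _))
    (Filter.Eventually.of_forall fun θ _ => (Real.hasSum_cosh |x|).summable)
    intervalIntegrable_const
    (Filter.Eventually.of_forall fun θ _ => Real.hasSum_cos _)
  have hn : ∀ n : ℕ, 1 / Real.pi * ∫ θ in (0 : ℝ)..Real.pi,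
      (-1 : ℝ) ^ n * (x * Real.sin θ) ^ (2 * n) / ((2 * n).factorial : ℝ) =
      (-1 : ℝ) ^ n / (n.factorial : ℝ) ^ 2 * (x / 2) ^ (2 * n) := fun n => by
    have : ∀ θ : ℝ, (-1 : ℝ) ^ n * (x * Real.sin θ) ^ (2 * n) / ((2 * n).factorial : ℝ) =
        ((-1 : ℝ) ^ n * x ^ (2 * n) / ((2 * n).factorial : ℝ)) * Real.sin θ ^ (2 * n) := fun θ => by
      rw [mul_pow]; ring
    simp_rw [this]
    rw [intervalIntegral.integral_const_mul, integral_sin_pow_even, prod_odd_div_even, div_pow,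
      pow_mul 2]
    have := Real.pi_ne_zero
    field_simp
    norm_num
  have h' := h.mul_left (1 / Real.pi)
  simp only [hn] at h'
  exact h'

theorem J0_ofReal (x : ℝ) : J0 (x : ℂ) = (besselInt x : ℂ) := by
  rw [J0, ← (hasSum_besselInt x).tsum_eq, Complex.ofReal_tsum]
  push_cast
  rfl

theorem integral_odd_pow_mul_exp_neg_mul_sq (n : ℕ) {u : ℝ} (hu : 0 < u) :
    ∫ t in Set.Ioi (0 : ℝ), t ^ (2 * n + 1) * Real.exp (-u * t ^ 2) =
      (n.factorial : ℝ) / (2 * u ^ (n + 1)) := by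
  have h := _root_.integral_rpow_mul_exp_neg_mul_rpow (p := 2) (q := ((2 * n + 1 : ℕ) : ℝ)) (b := u)
    two_pos (by push_cast; linarith [n.cast_nonneg (α := ℝ)]) hu
  have e1 : ((((2 * n + 1 : ℕ) : ℝ)) + 1) / 2 = n + 1 := by push_cast; ring
  have e2 : -((((2 * n + 1 : ℕ) : ℝ)) + 1) / 2 = -((n + 1 : ℕ) : ℝ) := by push_cast; ring
  rw [e1, e2, Real.Gamma_nat_eq_factorial, Real.rpow_neg hu.le, Real.rpow_natCast] at h
  simp only [Real.rpow_natCast, Real.rpow_two] at h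
  rw [h]
  field_simp

theorem integrableOn_pow_mul_exp_neg_mul_sq (n : ℕ) {u : ℝ} (hu : 0 < u) :
    IntegrableOn (fun t : ℝ => t ^ n * Real.exp (-u * t ^ 2)) (Set.Ioi 0) := by
  have h := integrable_rpow_mul_exp_neg_mul_sq hu (s := n)
    (by linarith [n.cast_nonneg (α := ℝ)])
  simpa using h.integrableOn

theorem integral_besselInt_mul_gaussian (ρ : ℝ) {u : ℝ} (hu : 0 < u) :
    ∫ t in Set.Ioi (0 : ℝ), t * besselInt (t * ρ) * Real.exp (-u * t ^ 2) =
      Real.exp (-(ρ ^ 2 / (4 * u))) / (2 * u) := by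
  set c : ℕ → ℝ := fun n => (-1 : ℝ) ^ n / (n.factorial : ℝ) ^ 2 * (ρ / 2) ^ (2 * n) with hc
  set F : ℕ → ℝ → ℝ := fun n t => c n * (t ^ (2 * n + 1) * Real.exp (-u * t ^ 2)) with hF
  have hcn : ∀ n, c n * ((n.factorial : ℝ) / (2 * u ^ (n + 1))) =
      1 / (2 * u) * ((-(ρ ^ 2 / (4 * u))) ^ n / n.factorial) := fun n => by
    have : (-(ρ ^ 2 / (4 * u))) ^ n = (-1) ^ n * ρ ^ (2 * n) / (4 ^ n * u ^ n) := by
      rw [neg_eq_neg_one_mul, mul_pow, div_pow, mul_pow, pow_mul]; ring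
    rw [this, hc]
    simp only [div_pow, pow_mul (2 : ℝ)]
    field_simp
    norm_num
    ring
  have hint : ∀ n, ∫ t in Set.Ioi (0 : ℝ), F n t =
      1 / (2 * u) * ((-(ρ ^ 2 / (4 * u))) ^ n / n.factorial) := fun n => by
    rw [integral_const_mul, integral_odd_pow_mul_exp_neg_mul_sq n hu, hcn]
  have hnorm : ∀ n, ∫ t in Set.Ioi (0 : ℝ), ‖F n t‖ =
      ‖1 / (2 * u) * ((-(ρ ^ 2 / (4 * u))) ^ n / n.factorial)‖ := fun n => by
    rw [← hcn, norm_mul, Real.norm_of_nonneg (r := (n.factorial : ℝ) / _) (by positivity),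
      ← integral_odd_pow_mul_exp_neg_mul_sq n hu, ← integral_const_mul]
    refine setIntegral_congr_fun measurableSet_Ioi fun t ht => ?_
    have : (0 : ℝ) < t := ht
    simp only [hF]
    rw [norm_mul, Real.norm_of_nonneg (r := t ^ _ * _) (by positivity)]
  have hs : Summable fun n : ℕ => 1 / (2 * u) * ((-(ρ ^ 2 / (4 * u))) ^ n / n.factorial) :=
    (Real.summable_pow_div_factorial _).mul_left _
  have h := hasSum_integral_of_summable_integral_norm (μ := volume.restrict (Set.Ioi (0 : ℝ)))
    (F := F) (fun n => (integrableOn_pow_mul_exp_neg_mul_sq (2 * n + 1) hu).const_mul _)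
    (by simp_rw [hnorm]; exact hs.norm)
  simp_rw [hint] at h
  have hexp : HasSum (fun n : ℕ => 1 / (2 * u) * ((-(ρ ^ 2 / (4 * u))) ^ n / n.factorial))
      (1 / (2 * u) * Real.exp (-(ρ ^ 2 / (4 * u)))) := by
    have he : HasSum (fun n : ℕ => (-(ρ ^ 2 / (4 * u))) ^ n / (n.factorial : ℝ))
        (Real.exp (-(ρ ^ 2 / (4 * u)))) := by
      rw [Real.exp_eq_exp_ℝ]
      exact NormedSpace.expSeries_div_hasSum_exp (𝔸 := ℝ) _
    exact he.mul_left _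
  have := h.unique hexp
  rw [one_div_mul_eq_div] at this
  rw [← this]
  refine setIntegral_congr_fun measurableSet_Ioi fun t _ => ?_
  have ht : HasSum (fun n => F n t) (t * besselInt (t * ρ) * Real.exp (-u * t ^ 2)) := by
    have hn : ∀ n, F n t = t * ((-1 : ℝ) ^ n / (n.factorial : ℝ) ^ 2 * (t * ρ / 2) ^ (2 * n)) *
        Real.exp (-u * t ^ 2) := fun n => by
      simp only [hF, hc]
      rw [mul_div_assoc, mul_pow t]
      ring
    simp_rw [hn]
    have := ((hasSum_besselInt (t * ρ)).mul_left t).mul_right (Real.exp (-u * t ^ 2))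
    exact this
  exact ht.tsum_eq.symm

/-- The Cauchy–Schlömilch substitution: the measure `(a + b / v²) dv` on the half-line is carried
by `v ↦ a v - b / v` to Lebesgue measure on the line. -/
theorem cauchySchlomilch {a b : ℝ} (ha : 0 < a) (hb : 0 < b) :
    IntegrableOn (fun v : ℝ => (a + b / v ^ 2) * Real.exp (-(a * v - b / v) ^ 2)) (Set.Ioi 0) ∧
    ∫ v in Set.Ioi (0 : ℝ), (a + b / v ^ 2) * Real.exp (-(a * v - b / v) ^ 2) = √Real.pi := by
  have hd : ∀ v ∈ Set.Ioi (0 : ℝ),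
      HasDerivWithinAt (fun v : ℝ => a * v - b / v) (a + b / v ^ 2) (Set.Ioi 0) v := fun v hv => by
    have hv' : v ≠ 0 := (ne_of_gt hv)
    have := ((hasDerivAt_id v).const_mul a).sub ((hasDerivAt_inv hv').const_mul b)
    refine HasDerivAt.hasDerivWithinAt ?_
    refine this.congr_deriv ?_
    rw [mul_one, mul_neg, sub_neg_eq_add, div_eq_mul_inv]
  have hinj : Set.InjOn (fun v : ℝ => a * v - b / v) (Set.Ioi 0) := by
    refine StrictMonoOn.injOn fun v hv w _ hvw => ?_
    have hv' : (0 : ℝ) < v := hv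
    have : b / w < b / v := by gcongr
    have : a * v < a * w := by gcongr
    linarith
  have himg : (fun v : ℝ => a * v - b / v) '' Set.Ioi 0 = Set.univ := by
    refine Set.eq_univ_of_forall fun y => ?_
    have hsq : √(y ^ 2 + 4 * a * b) ^ 2 = y ^ 2 + 4 * a * b := Real.sq_sqrt (by positivity)
    have hlt : |y| < √(y ^ 2 + 4 * a * b) := by
      rw [← Real.sqrt_sq_eq_abs]
      exact Real.sqrt_lt_sqrt (sq_nonneg _) (by linarith [mul_pos ha hb])
    have hp : 0 < y + √(y ^ 2 + 4 * a * b) := by linarith [neg_abs_le y]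
    refine ⟨(y + √(y ^ 2 + 4 * a * b)) / (2 * a), Set.mem_Ioi.2 (by positivity), ?_⟩
    generalize √(y ^ 2 + 4 * a * b) = S at hsq hp
    have hw : b / ((y + S) / (2 * a)) = (S - y) / 2 := by
      rw [div_eq_iff (by positivity)]
      field_simp
      linear_combination -hsq
    simp only [hw]
    field_simp
    ring
  have habs : ∀ v ∈ Set.Ioi (0 : ℝ), |a + b / v ^ 2| • Real.exp (-1 * (a * v - b / v) ^ 2) =
      (a + b / v ^ 2) * Real.exp (-(a * v - b / v) ^ 2) := fun v _ => by
    rw [abs_of_pos (by positivity), smul_eq_mul, neg_one_mul]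
  constructor
  · refine (integrableOn_congr_fun habs measurableSet_Ioi).1 ?_
    rw [← integrableOn_image_iff_integrableOn_abs_deriv_smul measurableSet_Ioi hd hinj
      (fun x => Real.exp (-1 * x ^ 2)), himg, integrableOn_univ]
    exact integrable_exp_neg_mul_sq one_pos
  · rw [← setIntegral_congr_fun measurableSet_Ioi habs,
      ← integral_image_eq_integral_abs_deriv_smul measurableSet_Ioi hd hinj
        (fun x => Real.exp (-1 * x ^ 2)), himg, setIntegral_univ, integral_gaussian]
    simp

theorem integrableOn_exp_neg_sub_sq {a b : ℝ} (ha : 0 < a) (hb : 0 < b) :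
    IntegrableOn (fun v : ℝ => Real.exp (-(a * v - b / v) ^ 2)) (Set.Ioi 0) ∧
    IntegrableOn (fun v : ℝ => (v ^ 2)⁻¹ * Real.exp (-(a * v - b / v) ^ 2)) (Set.Ioi 0) := by
  have h := (cauchySchlomilch ha hb).1
  constructor
  · refine (h.const_mul a⁻¹).mono' (by fun_prop) (Filter.Eventually.of_forall fun v => ?_)
    rw [Real.norm_of_nonneg (by positivity), ← mul_assoc]
    refine le_mul_of_one_le_left (by positivity) ?_
    rw [mul_add, inv_mul_cancel₀ ha.ne']
    linarith [show 0 ≤ a⁻¹ * (b / v ^ 2) by positivity]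
  · refine (h.const_mul b⁻¹).mono' (by fun_prop) (Filter.Eventually.of_forall fun v => ?_)
    rw [Real.norm_of_nonneg (by positivity), ← mul_assoc]
    gcongr
    rw [mul_add, div_eq_mul_inv, inv_mul_cancel_left₀ hb.ne']
    linarith [show 0 ≤ a⁻¹ * b⁻¹ by positivity, show 0 ≤ b⁻¹ * a by positivity]

theorem integral_exp_neg_sub_sq_inversion {a b : ℝ} (ha : 0 < a) (hb : 0 < b) :
    ∫ v in Set.Ioi (0 : ℝ), Real.exp (-(a * v - b / v) ^ 2) =
      b / a * ∫ v in Set.Ioi (0 : ℝ), (v ^ 2)⁻¹ * Real.exp (-(a * v - b / v) ^ 2) := by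
  have hd : ∀ v ∈ Set.Ioi (0 : ℝ),
      HasDerivWithinAt (fun v : ℝ => b / a * v⁻¹) (b / a * (-(v ^ 2)⁻¹)) (Set.Ioi 0) v :=
    fun v hv => ((hasDerivAt_inv (ne_of_gt hv)).const_mul _).hasDerivWithinAt
  have hinj : Set.InjOn (fun v : ℝ => b / a * v⁻¹) (Set.Ioi 0) := fun v _ w _ h =>
    inv_injective (mul_left_cancel₀ (by positivity) h)
  have himg : (fun v : ℝ => b / a * v⁻¹) '' Set.Ioi 0 = Set.Ioi 0 := by
    ext y
    constructor
    · rintro ⟨v, hv, rfl⟩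
      have : (0 : ℝ) < v := hv
      exact Set.mem_Ioi.2 (by positivity)
    · intro hy
      have : (0 : ℝ) < y := hy
      exact ⟨b / a * y⁻¹, Set.mem_Ioi.2 (by positivity), by field_simp⟩
  have h := integral_image_eq_integral_abs_deriv_smul measurableSet_Ioi hd hinj
    (fun v => Real.exp (-(a * v - b / v) ^ 2))
  rw [himg] at h
  rw [h, ← integral_const_mul]
  refine setIntegral_congr_fun measurableSet_Ioi fun v hv => ?_
  have hv' : (0 : ℝ) < v := hv
  rw [mul_neg, abs_neg, abs_of_pos (by positivity), smul_eq_mul, mul_assoc]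
  congr 4
  field_simp
  ring

theorem integral_exp_neg_sub_sq {a b : ℝ} (ha : 0 < a) (hb : 0 < b) :
    ∫ v in Set.Ioi (0 : ℝ), Real.exp (-(a * v - b / v) ^ 2) = √Real.pi / (2 * a) ∧
    ∫ v in Set.Ioi (0 : ℝ), (v ^ 2)⁻¹ * Real.exp (-(a * v - b / v) ^ 2) =
      √Real.pi / (2 * b) := by
  obtain ⟨h1, h2⟩ := integrableOn_exp_neg_sub_sq ha hb
  have hinv := integral_exp_neg_sub_sq_inversion ha hb
  have hs := (cauchySchlomilch ha hb).2
  have : ∀ v : ℝ, (a + b / v ^ 2) * Real.exp (-(a * v - b / v) ^ 2) =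
      a * Real.exp (-(a * v - b / v) ^ 2) +
        b * ((v ^ 2)⁻¹ * Real.exp (-(a * v - b / v) ^ 2)) := fun v => by ring
  simp_rw [this] at hs
  rw [integral_add (h1.const_mul a) (h2.const_mul b), integral_const_mul, integral_const_mul,
    hinv] at hs
  have hI : ∫ v in Set.Ioi (0 : ℝ), (v ^ 2)⁻¹ * Real.exp (-(a * v - b / v) ^ 2) =
      √Real.pi / (2 * b) := by
    field_simp at hs ⊢
    linarith
  refine ⟨?_, hI⟩
  rw [hinv, hI]
  field_simp

theorem exp_neg_sq_mul_sq_sub (s c : ℝ) {v : ℝ} (hv : 0 < v) :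
    Real.exp (-(s ^ 2 * v ^ 2) - c ^ 2 / (4 * v ^ 2)) =
      Real.exp (-s * c) * Real.exp (-(s * v - c / 2 / v) ^ 2) := by
  rw [← Real.exp_add]
  congr 1
  field_simp
  ring

theorem integral_gaussian_subordination {s c : ℝ} (hs : 0 < s) (hc : 0 < c) :
    IntegrableOn (fun v : ℝ => Real.exp (-(s ^ 2 * v ^ 2) - c ^ 2 / (4 * v ^ 2))) (Set.Ioi 0) ∧
    ∫ v in Set.Ioi (0 : ℝ), Real.exp (-(s ^ 2 * v ^ 2) - c ^ 2 / (4 * v ^ 2)) =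
      √Real.pi / 2 * (Real.exp (-s * c) / s) := by
  have h := (integrableOn_exp_neg_sub_sq hs (half_pos hc)).1
  have hcongr : Set.EqOn (fun v : ℝ => Real.exp (-(s ^ 2 * v ^ 2) - c ^ 2 / (4 * v ^ 2)))
      (fun v => Real.exp (-s * c) * Real.exp (-(s * v - c / 2 / v) ^ 2)) (Set.Ioi 0) :=
    fun v hv => exp_neg_sq_mul_sq_sub s c hv
  refine ⟨(integrableOn_congr_fun hcongr measurableSet_Ioi).2 (h.const_mul _), ?_⟩
  rw [setIntegral_congr_fun measurableSet_Ioi hcongr, integral_const_mul,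
    (integral_exp_neg_sub_sq hs (half_pos hc)).1]
  field_simp

theorem integral_inv_sq_mul_gaussian {s c : ℝ} (hs : 0 < s) (hc : 0 < c) :
    ∫ v in Set.Ioi (0 : ℝ), (v ^ 2)⁻¹ * Real.exp (-(s ^ 2 * v ^ 2) - c ^ 2 / (4 * v ^ 2)) =
      √Real.pi * (Real.exp (-s * c) / c) := by
  have hcongr : Set.EqOn
      (fun v : ℝ => (v ^ 2)⁻¹ * Real.exp (-(s ^ 2 * v ^ 2) - c ^ 2 / (4 * v ^ 2)))
      (fun v => Real.exp (-s * c) * ((v ^ 2)⁻¹ * Real.exp (-(s * v - c / 2 / v) ^ 2)))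
      (Set.Ioi 0) := fun v hv => by
    simp only
    rw [exp_neg_sq_mul_sq_sub s c hv]
    ring
  rw [setIntegral_congr_fun measurableSet_Ioi hcongr, integral_const_mul,
    (integral_exp_neg_sub_sq hs (half_pos hc)).2]
  field_simp

/-- The Sommerfeld identity for the purely imaginary wave number `i κ`. -/
theorem sommerfeld_imaginary {κ Z : ℝ} (ρ : ℝ) (hκ : 0 < κ) (hZ : 0 < Z) :
    ∫ t in Set.Ioi (0 : ℝ), t * besselInt (t * ρ) *
      (Real.exp (-√(t ^ 2 + κ ^ 2) * Z) / √(t ^ 2 + κ ^ 2)) =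
    Real.exp (-κ * √(ρ ^ 2 + Z ^ 2)) / √(ρ ^ 2 + Z ^ 2) := by
  have hs : ∀ t : ℝ, 0 < √(t ^ 2 + κ ^ 2) := fun t => Real.sqrt_pos.2 (by positivity)
  have hsq : ∀ t : ℝ, √(t ^ 2 + κ ^ 2) ^ 2 = t ^ 2 + κ ^ 2 := fun t => Real.sq_sqrt (by positivity)
  have hts : ∀ t : ℝ, t ≤ √(t ^ 2 + κ ^ 2) := fun t => Real.le_sqrt_of_sq_le (by nlinarith)
  have hR : 0 < √(ρ ^ 2 + Z ^ 2) := Real.sqrt_pos.2 (by positivity)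
  have hRsq : √(ρ ^ 2 + Z ^ 2) ^ 2 = ρ ^ 2 + Z ^ 2 := Real.sq_sqrt (by positivity)
  set G : ℝ → ℝ → ℝ := fun t v => t * besselInt (t * ρ) *
    Real.exp (-(√(t ^ 2 + κ ^ 2) ^ 2 * v ^ 2) - Z ^ 2 / (4 * v ^ 2)) with hG
  have hjm : Measurable besselInt := continuous_besselInt.measurable
  have hGm : Measurable (Function.uncurry G) := by
    simp only [hG, Function.uncurry_def]
    fun_prop
  have hinner : ∀ t, ∫ v in Set.Ioi (0 : ℝ), G t v = √Real.pi / 2 * (t * besselInt (t * ρ) *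
      (Real.exp (-√(t ^ 2 + κ ^ 2) * Z) / √(t ^ 2 + κ ^ 2))) := fun t => by
    rw [integral_const_mul, (integral_gaussian_subordination (hs t) hZ).2]
    ring
  have hnorm : ∀ t, ∫ v in Set.Ioi (0 : ℝ), ‖G t v‖ = √Real.pi / 2 * (|t * besselInt (t * ρ)| *
      (Real.exp (-√(t ^ 2 + κ ^ 2) * Z) / √(t ^ 2 + κ ^ 2))) := fun t => by
    simp only [hG, norm_mul, Real.norm_eq_abs, Real.abs_exp]
    rw [integral_const_mul, (integral_gaussian_subordination (hs t) hZ).2, abs_mul]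
    ring
  have hint : Integrable (Function.uncurry G)
      ((volume.restrict (Set.Ioi (0 : ℝ))).prod (volume.restrict (Set.Ioi (0 : ℝ)))) := by
    rw [integrable_prod_iff hGm.aestronglyMeasurable]
    refine ⟨Filter.Eventually.of_forall fun t =>
      (integral_gaussian_subordination (hs t) hZ).1.const_mul (t * besselInt (t * ρ)), ?_⟩
    simp only [Function.uncurry_apply_pair, hnorm]
    refine Integrable.const_mul ?_ _
    refine Integrable.mono' (exp_neg_integrableOn_Ioi 0 hZ)
      (Measurable.aestronglyMeasurable (by fun_prop)) ?_
    refine (ae_restrict_mem measurableSet_Ioi).mono fun t ht => ?_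
    have ht0 : (0 : ℝ) < t := ht
    have hst := hs t
    have hexp : Real.exp (-√(t ^ 2 + κ ^ 2) * Z) ≤ Real.exp (-Z * t) :=
      Real.exp_le_exp.2 (by nlinarith [hts t])
    rw [Real.norm_of_nonneg (by positivity), abs_mul, abs_of_pos ht0]
    calc t * |besselInt (t * ρ)| * (Real.exp (-√(t ^ 2 + κ ^ 2) * Z) / √(t ^ 2 + κ ^ 2))
        ≤ √(t ^ 2 + κ ^ 2) * 1 * (Real.exp (-Z * t) / √(t ^ 2 + κ ^ 2)) := by
          gcongr
          · exact hts t
          · exact abs_besselInt_le_one _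
      _ = Real.exp (-Z * t) := by field_simp
  have hswap := integral_integral_swap hint
  simp only [hinner] at hswap
  rw [integral_const_mul] at hswap
  have hright : ∀ v ∈ Set.Ioi (0 : ℝ), ∫ t in Set.Ioi (0 : ℝ), G t v =
      1 / 2 * ((v ^ 2)⁻¹ *
        Real.exp (-(κ ^ 2 * v ^ 2) - √(ρ ^ 2 + Z ^ 2) ^ 2 / (4 * v ^ 2))) := fun v hv => by
    have hv0 : (0 : ℝ) < v := hv
    have : ∀ t, G t v = Real.exp (-(κ ^ 2 * v ^ 2) - Z ^ 2 / (4 * v ^ 2)) *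
        (t * besselInt (t * ρ) * Real.exp (-v ^ 2 * t ^ 2)) := fun t => by
      rw [mul_left_comm, ← Real.exp_add]
      simp only [hG]
      rw [hsq]
      congr 2
      ring
    simp_rw [this]
    rw [integral_const_mul, integral_besselInt_mul_gaussian ρ (by positivity : 0 < v ^ 2),
      mul_div_assoc', ← Real.exp_add, hRsq]
    have e : -(κ ^ 2 * v ^ 2) - Z ^ 2 / (4 * v ^ 2) + -(ρ ^ 2 / (4 * v ^ 2)) =
      -(κ ^ 2 * v ^ 2) - (ρ ^ 2 + Z ^ 2) / (4 * v ^ 2) := by ring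
    rw [e]
    field_simp
  rw [setIntegral_congr_fun measurableSet_Ioi hright, integral_const_mul,
    integral_inv_sq_mul_gaussian hκ hR] at hswap
  have hpi : √Real.pi ≠ 0 := (Real.sqrt_pos.2 Real.pi_pos).ne'
  refine mul_left_cancel₀ (div_ne_zero hpi two_ne_zero) (hswap.trans ?_)
  ring

/-- The square root of `t² - k²` with positive real part, for `k` in the upper half plane. -/
def sigma (k : ℂ) (t : ℝ) : ℂ := ((t : ℂ) ^ 2 - k ^ 2) ^ (1 / 2 : ℂ)

section sigma

variable {k : ℂ}

theorem sq_sub_sq_mem_slitPlane (hk : 0 < k.im) (t : ℝ) : (t : ℂ) ^ 2 - k ^ 2 ∈ slitPlane := by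
  rw [mem_slitPlane_iff]
  by_cases h : k.re = 0
  · left
    simp only [pow_two, sub_re, mul_re, ofReal_re, ofReal_im, h]
    nlinarith [mul_pos hk hk, mul_self_nonneg t]
  · right
    simp only [pow_two, sub_im, mul_im, ofReal_re, ofReal_im]
    intro h0
    apply mul_ne_zero h hk.ne'
    linarith

theorem sigma_sq (k : ℂ) (t : ℝ) : sigma k t ^ 2 = (t : ℂ) ^ 2 - k ^ 2 := by
  rw [sigma, ← cpow_nat_mul]
  norm_num

theorem sigma_re_pos (hk : 0 < k.im) (t : ℝ) : 0 < (sigma k t).re := by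
  have hw := sq_sub_sq_mem_slitPlane hk t
  have h1 := neg_pi_lt_arg ((t : ℂ) ^ 2 - k ^ 2)
  have h2 := (arg_le_pi ((t : ℂ) ^ 2 - k ^ 2)).lt_of_ne (slitPlane_arg_ne_pi hw)
  have him : (log ((t : ℂ) ^ 2 - k ^ 2) * (1 / 2 : ℂ)).im = arg ((t : ℂ) ^ 2 - k ^ 2) / 2 := by
    rw [mul_one_div, show (2 : ℂ) = ((2 : ℝ) : ℂ) by norm_num, div_ofReal_im, log_im]
  rw [sigma, cpow_def_of_ne_zero (slitPlane_ne_zero hw), exp_re, him]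
  exact mul_pos (Real.exp_pos _) (Real.cos_pos_of_mem_Ioo ⟨by linarith, by linarith⟩)

theorem sigma_ne_zero (hk : 0 < k.im) (t : ℝ) : sigma k t ≠ 0 := fun h => by
  simpa [h] using sigma_re_pos hk t

theorem im_le_norm_sigma (hk : 0 < k.im) (t : ℝ) : k.im ≤ ‖sigma k t‖ := by
  have h : ‖sigma k t‖ ^ 2 = ‖(t : ℂ) - k‖ * ‖(t : ℂ) + k‖ := by
    rw [← norm_pow, sigma_sq, ← norm_mul]
    ring_nf
  have h1 : k.im ≤ ‖(t : ℂ) - k‖ := by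
    have := abs_im_le_norm ((t : ℂ) - k)
    simp only [sub_im, ofReal_im, zero_sub, abs_neg] at this
    exact (le_abs_self _).trans this
  have h2 : k.im ≤ ‖(t : ℂ) + k‖ := by
    have := abs_im_le_norm ((t : ℂ) + k)
    simp only [add_im, ofReal_im, zero_add] at this
    exact (le_abs_self _).trans this
  refine (sq_le_sq₀ hk.le (norm_nonneg _)).1 ?_
  rw [h, sq]
  gcongr

theorem sub_norm_le_sigma_re (hk : 0 < k.im) (t : ℝ) : t - ‖k‖ ≤ (sigma k t).re := by
  have h := congrArg re (sigma_sq k t)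
  simp only [pow_two, sub_re, mul_re, ofReal_re, ofReal_im] at h
  have hn : ‖k‖ ^ 2 = k.re ^ 2 + k.im ^ 2 := by rw [← normSq_eq_norm_sq, normSq_apply]; ring
  have hp := sigma_re_pos hk t
  by_contra! hlt
  nlinarith [norm_nonneg k, sq_nonneg (sigma k t).im, sq_nonneg k.im]

theorem norm_exp_neg_sigma_le (hk : 0 < k.im) {Z : ℝ} (hZ : 0 < Z) (t : ℝ) :
    ‖exp (-sigma k t * Z)‖ ≤ Real.exp (‖k‖ * Z) * Real.exp (-Z * t) := by
  rw [norm_exp, ← Real.exp_add, re_mul_ofReal, neg_re]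
  refine Real.exp_le_exp.2 ?_
  nlinarith [sub_norm_le_sigma_re hk t]

theorem hasDerivAt_sigma (hk : 0 < k.im) (t : ℝ) :
    HasDerivAt (fun k => sigma k t) (-k / sigma k t) k := by
  have hw := sq_sub_sq_mem_slitPlane hk t
  have hs := sigma_ne_zero hk t
  have h := (((hasDerivAt_id k).pow 2).const_sub ((t : ℂ) ^ 2)).cpow_const (c := 1 / 2) hw
  refine h.congr_deriv ?_
  have e : ((t : ℂ) ^ 2 - id k ^ 2) ^ ((1 / 2 : ℂ) - 1) = (sigma k t)⁻¹ := by
    rw [id, cpow_sub _ _ (slitPlane_ne_zero hw), cpow_one]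
    change sigma k t / _ = _
    rw [← sigma_sq]
    field_simp
  simp only [Pi.pow_apply]
  rw [e]
  simp
  field_simp

theorem hasDerivAt_exp_neg_sigma_div (hk : 0 < k.im) (Z t : ℝ) :
    HasDerivAt (fun k => exp (-sigma k t * Z) / sigma k t)
      (exp (-sigma k t * Z) * (k * (Z / sigma k t ^ 2 + 1 / sigma k t ^ 3))) k := by
  have hs := sigma_ne_zero hk t
  have h := hasDerivAt_sigma hk t
  refine (((h.neg.mul_const (Z : ℂ)).cexp).div h hs).congr_deriv ?_
  simp only [Pi.neg_apply]
  field_simp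
  ring

end sigma

/-- The Sommerfeld integral, written with `sigma = -i k_z`. -/
def sommerfeldIntegral (ρ Z : ℝ) (k : ℂ) : ℂ :=
  ∫ t in Set.Ioi (0 : ℝ), ((t * besselInt (t * ρ) : ℝ) : ℂ) * (exp (-sigma k t * Z) / sigma k t)

theorem integrableOn_mul_exp_neg {Z : ℝ} (hZ : 0 < Z) :
    IntegrableOn (fun t : ℝ => t * Real.exp (-Z * t)) (Set.Ioi 0) := by
  have h := integrableOn_rpow_mul_exp_neg_mul_rpow (s := 1) (p := 1) (by norm_num) one_pos hZ
  simpa only [Real.rpow_one] using h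

theorem norm_mul_besselInt_le {t : ℝ} (ht : 0 < t) (ρ : ℝ) :
    ‖((t * besselInt (t * ρ) : ℝ) : ℂ)‖ ≤ t := by
  rw [norm_real, norm_mul, Real.norm_of_nonneg ht.le, Real.norm_eq_abs]
  exact mul_le_of_le_one_right ht.le (abs_besselInt_le_one _)

theorem measurable_sommerfeld_integrand (ρ Z : ℝ) (k : ℂ) : Measurable fun t : ℝ =>
    ((t * besselInt (t * ρ) : ℝ) : ℂ) * (exp (-sigma k t * Z) / sigma k t) := by
  have hjm : Measurable besselInt := continuous_besselInt.measurable
  unfold sigma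
  fun_prop

theorem integrableOn_sommerfeld_integrand {Z : ℝ} (ρ : ℝ) (hZ : 0 < Z) {k : ℂ} (hk : 0 < k.im) :
    IntegrableOn (fun t : ℝ =>
      ((t * besselInt (t * ρ) : ℝ) : ℂ) * (exp (-sigma k t * Z) / sigma k t)) (Set.Ioi 0) := by
  refine Integrable.mono' ((integrableOn_mul_exp_neg hZ).const_mul (Real.exp (‖k‖ * Z) / k.im))
    (measurable_sommerfeld_integrand ρ Z k).aestronglyMeasurable ?_
  refine (ae_restrict_mem measurableSet_Ioi).mono fun t ht => ?_
  have ht0 : (0 : ℝ) < t := ht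
  rw [norm_mul, norm_div]
  calc _ ≤ t * (Real.exp (‖k‖ * Z) * Real.exp (-Z * t) / k.im) := by
        gcongr
        · exact norm_mul_besselInt_le ht0 ρ
        · exact norm_exp_neg_sigma_le hk hZ t
        · exact im_le_norm_sigma hk t
    _ = _ := by ring

theorem differentiableAt_sommerfeldIntegral {Z : ℝ} (ρ : ℝ) (hZ : 0 < Z) {k : ℂ} (hk : 0 < k.im) :
    DifferentiableAt ℂ (sommerfeldIntegral ρ Z) k := by
  set δ : ℝ := k.im / 2 with hδ
  have hδ0 : 0 < δ := half_pos hk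
  set M : ℝ := ‖k‖ + δ with hM
  have hM0 : 0 < M := by positivity
  have him : ∀ w ∈ Metric.ball k δ, δ < w.im := fun w hw => by
    have h := abs_im_le_norm (w - k)
    rw [sub_im] at h
    have := mem_ball_iff_norm.1 hw
    linarith [neg_abs_le (w.im - k.im)]
  have hnorm : ∀ w ∈ Metric.ball k δ, ‖w‖ ≤ M := fun w hw => by
    have := mem_ball_iff_norm.1 hw
    linarith [norm_sub_norm_le w k]
  refine (hasDerivAt_integral_of_dominated_loc_of_deriv_le (Metric.ball_mem_nhds k hδ0)
    (bound := fun t => Real.exp (M * Z) * (M * (Z / δ ^ 2 + 1 / δ ^ 3)) * (t * Real.exp (-Z * t)))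
    (F' := fun k t => ((t * besselInt (t * ρ) : ℝ) : ℂ) *
      (exp (-sigma k t * Z) * (k * (Z / sigma k t ^ 2 + 1 / sigma k t ^ 3))))
    (Filter.Eventually.of_forall fun w =>
      (measurable_sommerfeld_integrand ρ Z w).aestronglyMeasurable)
    (integrableOn_sommerfeld_integrand ρ hZ hk) ?_ ?_
    ((integrableOn_mul_exp_neg hZ).const_mul _) ?_).2.differentiableAt
  · have hjm : Measurable besselInt := continuous_besselInt.measurable
    unfold sigma
    exact Measurable.aestronglyMeasurable (by fun_prop)
  · refine (ae_restrict_mem measurableSet_Ioi).mono fun t ht w hw => ?_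
    have ht0 : (0 : ℝ) < t := ht
    have hw0 : 0 < w.im := hδ0.trans (him w hw)
    have hσ : δ ≤ ‖sigma w t‖ := (him w hw).le.trans (im_le_norm_sigma hw0 t)
    have hsum : ‖(Z : ℂ) / sigma w t ^ 2 + 1 / sigma w t ^ 3‖ ≤ Z / δ ^ 2 + 1 / δ ^ 3 := by
      refine (norm_add_le _ _).trans ?_
      rw [norm_div, norm_div, norm_one, norm_pow, norm_pow, norm_real, Real.norm_of_nonneg hZ.le]
      gcongr
    rw [norm_mul, norm_mul, norm_mul]
    calc _ ≤ t * (Real.exp (M * Z) * Real.exp (-Z * t) * (M * (Z / δ ^ 2 + 1 / δ ^ 3))) := by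
          gcongr
          · exact norm_mul_besselInt_le ht0 ρ
          · refine (norm_exp_neg_sigma_le hw0 hZ t).trans ?_
            gcongr
            exact hnorm w hw
          · exact hnorm w hw
      _ = _ := by ring
  · exact Filter.Eventually.of_forall fun t w hw =>
      (hasDerivAt_exp_neg_sigma_div (hδ0.trans (him w hw)) Z t).const_mul _

theorem sigma_ofReal_mul_I (κ t : ℝ) (hκ : 0 < κ) : sigma (κ * I) t = (√(t ^ 2 + κ ^ 2) : ℝ) := by
  have h1 : sigma (κ * I) t ^ 2 = ((√(t ^ 2 + κ ^ 2) : ℝ) : ℂ) ^ 2 := by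
    rw [sigma_sq, ← ofReal_pow √_, Real.sq_sqrt (by positivity), mul_pow, I_sq]
    push_cast
    ring
  rcases sq_eq_sq_iff_eq_or_eq_neg.1 h1 with h | h
  · exact h
  · have h2 := sigma_re_pos (k := κ * I) (by simpa using hκ) t
    rw [h, neg_re, ofReal_re] at h2
    linarith [Real.sqrt_nonneg (t ^ 2 + κ ^ 2)]

theorem sommerfeldIntegral_ofReal_mul_I {κ Z : ℝ} (ρ : ℝ) (hκ : 0 < κ) (hZ : 0 < Z) :
    sommerfeldIntegral ρ Z (κ * I) =
      exp (I * (κ * I) * (√(ρ ^ 2 + Z ^ 2) : ℝ)) / (√(ρ ^ 2 + Z ^ 2) : ℝ) := by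
  have h := congrArg (fun x : ℝ => (x : ℂ)) (sommerfeld_imaginary ρ hκ hZ)
  rw [← integral_complex_ofReal] at h
  rw [sommerfeldIntegral]
  simp only [sigma_ofReal_mul_I κ _ hκ]
  push_cast at h ⊢
  rw [h, mul_left_comm, I_mul_I, mul_neg_one]

theorem sommerfeldIntegral_eq {Z : ℝ} (ρ : ℝ) (hZ : 0 < Z) {k : ℂ} (hk : 0 < k.im) :
    sommerfeldIntegral ρ Z k =
      exp (I * k * (√(ρ ^ 2 + Z ^ 2) : ℝ)) / (√(ρ ^ 2 + Z ^ 2) : ℝ) := by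
  have hopen : IsOpen {w : ℂ | 0 < w.im} := isOpen_lt continuous_const continuous_im
  have hconn : IsPreconnected {w : ℂ | 0 < w.im} := (convex_halfSpace_im_gt 0).isPreconnected
  have hF : AnalyticOnNhd ℂ (sommerfeldIntegral ρ Z) {w : ℂ | 0 < w.im} :=
    DifferentiableOn.analyticOnNhd
      (fun w hw => (differentiableAt_sommerfeldIntegral ρ hZ hw).differentiableWithinAt) hopen
  have hE : AnalyticOnNhd ℂ (fun w : ℂ => exp (I * w * (√(ρ ^ 2 + Z ^ 2) : ℝ)) /
      (√(ρ ^ 2 + Z ^ 2) : ℝ)) {w : ℂ | 0 < w.im} :=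
    DifferentiableOn.analyticOnNhd (by fun_prop) hopen
  refine hF.eqOn_of_preconnected_of_frequently_eq hE hconn (z₀ := I) (by simp) ?_ hk
  have ht : Filter.Tendsto (fun κ : ℝ => (κ : ℂ) * I) (nhdsWithin 1 {1}ᶜ) (nhdsWithin I {I}ᶜ) := by
    refine tendsto_nhdsWithin_iff.2 ⟨?_, ?_⟩
    · have : Continuous fun κ : ℝ => (κ : ℂ) * I := by fun_prop
      simpa using (this.tendsto 1).mono_left nhdsWithin_le_nhds
    · filter_upwards [self_mem_nhdsWithin] with κ hκ h
      exact hκ (by simpa using h)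
  refine ht.frequently (Filter.Eventually.frequently ?_)
  filter_upwards [mem_nhdsWithin_of_mem_nhds (lt_mem_nhds one_pos)] with κ hκ
  exact sommerfeldIntegral_ofReal_mul_I ρ hκ hZ

theorem eq_I_mul_sigma {k : ℂ} (hk : 0 < k.im) {t : ℝ} {w : ℂ} (hw : w ^ 2 = k ^ 2 - (t : ℂ) ^ 2)
    (him : 0 < w.im) : w = I * sigma k t := by
  have h : w ^ 2 = (I * sigma k t) ^ 2 := by
    rw [hw, mul_pow, I_sq, sigma_sq]
    ring
  rcases sq_eq_sq_iff_eq_or_eq_neg.1 h with h | h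
  · exact h
  · rw [h, neg_im, I_mul_im] at him
    linarith [sigma_re_pos hk t]

/-- Sommerfeld identity: for k ∈ ℂ with Re k > 0 and Im k > 0, a point
r = (x, y, z) ∈ ℝ³ with z ≠ 0, ρ = √(x² + y²), and k_z : ℝ → ℂ any choice of square roots
k_z(t)² = k² − t² with Im k_z(t) > 0 (such a root exists and is unique since
Im(k² − t²) = 2 Re k Im k > 0), the integrand t J₀(tρ) e^{i k_z(t)|z|}/k_z(t) is
(absolutely) integrable on [0, ∞) and
h₀⁽¹⁾(k‖r‖) = (1/k) ∫₀^∞ t J₀(tρ) e^{i k_z(t)|z|}/k_z(t) dt. -/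
theorem statement7 (k : ℂ) (hre : 0 < k.re) (him : 0 < k.im)
    (x y z : ℝ) (hz : z ≠ 0)
    (kz : ℝ → ℂ)
    (hkz : ∀ t : ℝ, 0 ≤ t → (kz t) ^ 2 = k ^ 2 - (t : ℂ) ^ 2 ∧ 0 < (kz t).im) :
    MeasureTheory.IntegrableOn
      (fun t : ℝ => (t : ℂ) * J0 ((t : ℂ) * (Real.sqrt (x ^ 2 + y ^ 2) : ℂ)) *
        Complex.exp (I * kz t * ((|z| : ℝ) : ℂ)) / kz t) (Set.Ici 0) ∧
    h0 (k * (Real.sqrt (x ^ 2 + y ^ 2 + z ^ 2) : ℂ)) =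
      (1 / k) * ∫ t in Set.Ici (0 : ℝ),
        (t : ℂ) * J0 ((t : ℂ) * (Real.sqrt (x ^ 2 + y ^ 2) : ℂ)) *
          Complex.exp (I * kz t * ((|z| : ℝ) : ℂ)) / kz t := by
  have hZ : 0 < |z| := abs_pos.2 hz
  set ρ : ℝ := √(x ^ 2 + y ^ 2) with hρ
  have hρsq : ρ ^ 2 = x ^ 2 + y ^ 2 := Real.sq_sqrt (by positivity)
  have hR : ρ ^ 2 + |z| ^ 2 = x ^ 2 + y ^ 2 + z ^ 2 := by rw [hρsq, sq_abs]
  have hR0 : (√(x ^ 2 + y ^ 2 + z ^ 2) : ℂ) ≠ 0 :=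
    ofReal_ne_zero.2 (Real.sqrt_pos.2 (by positivity)).ne'
  have hk0 : k ≠ 0 := fun h => by simp [h] at him
  have hcongr : Set.EqOn
      (fun t : ℝ => (t : ℂ) * J0 ((t : ℂ) * (ρ : ℂ)) *
        Complex.exp (I * kz t * ((|z| : ℝ) : ℂ)) / kz t)
      (fun t : ℝ => I⁻¹ * (((t * besselInt (t * ρ) : ℝ) : ℂ) *
        (exp (-sigma k t * (|z| : ℝ)) / sigma k t))) (Set.Ioi 0) := fun t ht => by
    have ht0 : (0 : ℝ) < t := ht
    obtain ⟨h1, h2⟩ := hkz t ht0.le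
    have hs := sigma_ne_zero him t
    simp only
    rw [eq_I_mul_sigma him h1 h2, ← ofReal_mul t ρ, J0_ofReal, ← mul_assoc I I, I_mul_I,
      neg_one_mul, ofReal_mul t (besselInt _)]
    field_simp
  constructor
  · rw [integrableOn_Ici_iff_integrableOn_Ioi, integrableOn_congr_fun hcongr measurableSet_Ioi]
    exact (integrableOn_sommerfeld_integrand ρ hZ him).const_mul _
  · rw [integral_Ici_eq_integral_Ioi, setIntegral_congr_fun measurableSet_Ioi hcongr,
      integral_const_mul]
    change _ = 1 / k * (I⁻¹ * sommerfeldIntegral ρ |z| k)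
    rw [sommerfeldIntegral_eq ρ hZ him, hR, h0, ← mul_assoc I k]
    field_simp

end
end

section
/- Three-layer transmission problem with the source in the middle layer: let −d < z' < 0 and define b₀ = i k₁ κ₂₃ / D, a₁ = i (k₁k₁z − k₀k₀z) κ₂₃ e^{idk₁z}/(2k₁z D), b₁ = i (k₁k₁z − k₂k₂z) κ₂₂ e^{idk₁z}/(2k₁z D), a₂ = i k₁ κ₂₂ e^{id(k₁z − k₂z)}/D. Define û₀(z) = b₀ e^{ik₀z z}, û₁(z) = a₁ e^{−ik₁z(z+d)} + b₁ e^{ik₁z(z+d)} + (i/(2k₁z)) e^{ik₁z|z − z'|}, û₂(z) = a₂ e^{−ik₂z z}. Then: (1) û₀(0) = û₁(0); (2) k₀ û₀'(0) = k₁ û₁'(0); (3) û₁(−d) = û₂(−d); (4) k₁ û₁'(−d) = k₂ û₂'(−d); (5) û₀'' + k₀z² û₀ = 0 on (0, ∞), û₁'' + k₁z² û₁ = 0 on (−d, z') ∪ (z', 0), and û₂'' + k₂z² û₂ = 0 on (−∞, −d); (6) û₁ is continuous at z' with û₁'(z'⁺) − û₁'(z'⁻) = −1. -/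
open Complex

noncomputable section

/-- The one-dimensional field `A e^{-iqz} + B e^{iqz}`. -/
def planeWave (q A B : ℂ) (z : ℝ) : ℂ :=
  A * Complex.exp (-(I * q * (z : ℂ))) + B * Complex.exp (I * q * (z : ℂ))

theorem hasDerivAt_planeWave (q A B : ℂ) (z : ℝ) :
    HasDerivAt (planeWave q A B) (planeWave q (-(I * q * A)) (I * q * B) z) z := by
  have h : HasDerivAt (fun x : ℝ => I * q * (x : ℂ)) (I * q) z := by
    simpa using (Complex.ofRealCLM.hasDerivAt (x := z)).const_mul (I * q)
  refine ((h.fun_neg.cexp.const_mul A).add (h.cexp.const_mul B)).congr_deriv ?_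
  simp only [planeWave]
  ring

theorem deriv_planeWave (q A B : ℂ) :
    deriv (planeWave q A B) = planeWave q (-(I * q * A)) (I * q * B) :=
  funext fun z => (hasDerivAt_planeWave q A B z).deriv

theorem deriv_deriv_planeWave_add (q A B : ℂ) (z : ℝ) :
    deriv (deriv (planeWave q A B)) z + q ^ 2 * planeWave q A B z = 0 := by
  simp only [deriv_planeWave, planeWave]
  linear_combination (q ^ 2 * (A * Complex.exp (-(I * q * (z : ℂ))) +
    B * Complex.exp (I * q * (z : ℂ)))) * I_sq

theorem deriv_deriv_add_eq_zero_of_eqOn {u : ℝ → ℂ} {s : Set ℝ} {q A B : ℂ} (hs : IsOpen s)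
    (h : Set.EqOn u (planeWave q A B) s) {z : ℝ} (hz : z ∈ s) :
    deriv (deriv u) z + q ^ 2 * u z = 0 := by
  have hev : u =ᶠ[nhds z] planeWave q A B := h.eventuallyEq_of_mem (hs.mem_nhds hz)
  rw [hev.deriv.deriv_eq, hev.eq_of_nhds, deriv_deriv_planeWave_add]

/-- three-layer transmission problem (interfaces at z = 0 and z = −d)
with the source in the middle layer −d < z' < 0: the spectral-domain Green's function
components û₀, û₁, û₂ built from the coefficients b₀, a₁, b₁, a₂ satisfy the transmission
conditions at both interfaces, the homogeneous ODEs in each layer away from the source,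
and the unit derivative-jump condition at the source z'. -/
theorem statement14 (k0 k1 k2 k0z k1z k2z : ℂ)
    (h0z : k0z ≠ 0) (h1z : k1z ≠ 0) (h2z : k2z ≠ 0)
    (d : ℝ) (hd : 0 < d)
    (z' : ℝ) (hz'1 : -d < z') (hz'2 : z' < 0)
    (κ11 κ12 κ22 κ23 D : ℂ)
    (h11 : κ11 = ((k1 * k1z - k2 * k2z) / 2) * Complex.exp (2 * I * (d : ℂ) * k1z) +
      (k1 * k1z + k2 * k2z) / 2)
    (h12 : κ12 = I * (((k2 * k2z - k1 * k1z) / 2) * Complex.exp (2 * I * (d : ℂ) * k1z) +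
      (k1 * k1z + k2 * k2z) / 2))
    (h22 : κ22 = ((k1 * k1z + k0 * k0z) / 2) * Complex.exp (I * k1z * (z' : ℂ)) +
      ((k1 * k1z - k0 * k0z) / 2) * Complex.exp (-(I * k1z * (z' : ℂ))))
    (h23 : κ23 = ((k1 * k1z - k2 * k2z) / 2) *
        Complex.exp (I * k1z * (2 * (d : ℂ) + (z' : ℂ))) +
      ((k1 * k1z + k2 * k2z) / 2) * Complex.exp (-(I * k1z * (z' : ℂ))))
    (hD : D = k0 * k0z * κ11 - I * k1 * k1z * κ12) (hDne : D ≠ 0)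
    (b0 a1 b1 a2 : ℂ)
    (hb0 : b0 = I * k1 * κ23 / D)
    (ha1 : a1 = I * (k1 * k1z - k0 * k0z) * κ23 * Complex.exp (I * (d : ℂ) * k1z) /
      (2 * k1z * D))
    (hb1 : b1 = I * (k1 * k1z - k2 * k2z) * κ22 * Complex.exp (I * (d : ℂ) * k1z) /
      (2 * k1z * D))
    (ha2 : a2 = I * k1 * κ22 * Complex.exp (I * (d : ℂ) * (k1z - k2z)) / D)
    (u0 u1 u2 : ℝ → ℂ)
    (hu0 : ∀ z : ℝ, u0 z = b0 * Complex.exp (I * k0z * (z : ℂ)))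
    (hu1 : ∀ z : ℝ, u1 z = a1 * Complex.exp (-(I * k1z * ((z : ℂ) + (d : ℂ)))) +
      b1 * Complex.exp (I * k1z * ((z : ℂ) + (d : ℂ))) +
      (I / (2 * k1z)) * Complex.exp (I * k1z * ((|z - z'| : ℝ) : ℂ)))
    (hu2 : ∀ z : ℝ, u2 z = a2 * Complex.exp (-(I * k2z * (z : ℂ)))) :
    u0 0 = u1 0 ∧
    k0 * deriv u0 0 = k1 * deriv u1 0 ∧
    u1 (-d) = u2 (-d) ∧
    k1 * deriv u1 (-d) = k2 * deriv u2 (-d) ∧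
    ((∀ z ∈ Set.Ioi (0 : ℝ), deriv (deriv u0) z + k0z ^ 2 * u0 z = 0) ∧
      (∀ z ∈ Set.Ioo (-d) z' ∪ Set.Ioo z' (0 : ℝ),
        deriv (deriv u1) z + k1z ^ 2 * u1 z = 0) ∧
      (∀ z ∈ Set.Iio (-d), deriv (deriv u2) z + k2z ^ 2 * u2 z = 0)) ∧
    (ContinuousAt u1 z' ∧
      derivWithin u1 (Set.Ici z') z' - derivWithin u1 (Set.Iic z') z' = -1) := by
  have hu0' : u0 = planeWave k0z 0 b0 := by
    funext z; simp [hu0, planeWave]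
  have hu2' : u2 = planeWave k2z a2 0 := by
    funext z; simp [hu2, planeWave]
  have hright : Set.EqOn u1 (planeWave k1z (a1 * Complex.exp (-(I * d * k1z)))
      (b1 * Complex.exp (I * d * k1z) + I / (2 * k1z) * Complex.exp (-(I * k1z * z'))))
      (Set.Ici z') := by
    intro z hz
    rw [hu1, abs_of_nonneg (sub_nonneg.2 hz), planeWave, add_mul, mul_assoc a1, mul_assoc b1,
      mul_assoc (I / (2 * k1z)), ← Complex.exp_add, ← Complex.exp_add, ← Complex.exp_add, add_assoc]
    push_cast
    ring_nf
  have hleft : Set.EqOn u1 (planeWave k1z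
      (a1 * Complex.exp (-(I * d * k1z)) + I / (2 * k1z) * Complex.exp (I * k1z * z'))
      (b1 * Complex.exp (I * d * k1z))) (Set.Iic z') := by
    intro z hz
    rw [hu1, abs_of_nonpos (sub_nonpos.2 hz), planeWave, add_mul, mul_assoc a1, mul_assoc b1,
      mul_assoc (I / (2 * k1z)), ← Complex.exp_add, ← Complex.exp_add, ← Complex.exp_add]
    push_cast
    ring_nf
  have hright0 := hright.eventuallyEq_of_mem (Ici_mem_nhds hz'2)
  have hleftd := hleft.eventuallyEq_of_mem (Iic_mem_nhds hz'1)
  have hdr := (hasDerivAt_planeWave _ _ _ z').hasDerivWithinAt.congr_of_mem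
    (fun x hx => hright hx) Set.self_mem_Ici
  have hdl := (hasDerivAt_planeWave _ _ _ z').hasDerivWithinAt.congr_of_mem
    (fun x hx => hleft hx) Set.self_mem_Iic
  have hE2 : Complex.exp (2 * I * d * k1z) = Complex.exp (I * d * k1z) ^ 2 := by
    rw [← Complex.exp_nat_mul]; push_cast; ring_nf
  have hE2P : Complex.exp (I * k1z * (2 * d + z')) =
      Complex.exp (I * d * k1z) ^ 2 * Complex.exp (I * k1z * z') := by
    rw [← Complex.exp_nat_mul, ← Complex.exp_add]; push_cast; ring_nf
  have hEF : Complex.exp (I * d * (k1z - k2z)) =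
      Complex.exp (I * d * k1z) * (Complex.exp (I * k2z * d))⁻¹ := by
    rw [← Complex.exp_neg, ← Complex.exp_add]; ring_nf
  have hcomm : I * k1z * (d : ℂ) = I * d * k1z := by ring
  rw [hE2] at h11 h12
  rw [hE2P] at h23
  rw [hEF] at ha2
  rw [Complex.exp_neg] at h22 h23
  have hE := Complex.exp_ne_zero (I * d * k1z)
  have hP := Complex.exp_ne_zero (I * k1z * z')
  have hF := Complex.exp_ne_zero (I * k2z * d)
  have hD' : D = ((k0 * k0z + k1 * k1z) * (k1 * k1z + k2 * k2z) -
      (k1 * k1z - k0 * k0z) * (k1 * k1z - k2 * k2z) * Complex.exp (I * d * k1z) ^ 2) / 2 := by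
    rw [hD, h11, h12]
    linear_combination (-(k1 * k1z) * (((k2 * k2z - k1 * k1z) / 2) *
      Complex.exp (I * d * k1z) ^ 2 + (k1 * k1z + k2 * k2z) / 2)) * I_sq
  refine ⟨?_, ?_, ?_, ?_, ⟨?_, ?_, ?_⟩, ?_, ?_⟩
  · rw [hright0.eq_of_nhds, hu0']
    simp only [planeWave, Complex.exp_neg, ofReal_zero, mul_zero, Complex.exp_zero, inv_one]
    generalize Complex.exp (I * d * k1z) = E at *
    generalize Complex.exp (I * k1z * z') = P at *
    subst hb0 ha1 hb1
    field_simp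
    rw [hD', h22, h23]
    field_simp
    ring
  · rw [hright0.deriv_eq, hu0', deriv_planeWave, deriv_planeWave]
    simp only [planeWave, Complex.exp_neg, ofReal_zero, mul_zero, Complex.exp_zero, inv_one]
    generalize Complex.exp (I * d * k1z) = E at *
    generalize Complex.exp (I * k1z * z') = P at *
    subst hb0 ha1 hb1
    field_simp
    rw [hD', h22, h23]
    field_simp
    ring
  · rw [hleftd.eq_of_nhds, hu2']
    simp only [planeWave, Complex.exp_neg, ofReal_neg, mul_neg, neg_neg, hcomm]
    generalize Complex.exp (I * d * k1z) = E at *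
    generalize Complex.exp (I * k1z * z') = P at *
    generalize Complex.exp (I * k2z * d) = F at *
    subst ha2 ha1 hb1
    field_simp
    rw [hD', h22, h23]
    field_simp
    ring
  · rw [hleftd.deriv_eq, hu2', deriv_planeWave, deriv_planeWave]
    simp only [planeWave, Complex.exp_neg, ofReal_neg, mul_neg, neg_neg, hcomm]
    generalize Complex.exp (I * d * k1z) = E at *
    generalize Complex.exp (I * k1z * z') = P at *
    generalize Complex.exp (I * k2z * d) = F at *
    subst ha2 ha1 hb1
    field_simp
    rw [hD', h22, h23]
    field_simp
    ring
  · exact fun z hz => deriv_deriv_add_eq_zero_of_eqOn isOpen_Ioi (fun x _ => congrFun hu0' x) hz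
  · rintro z (hz | hz)
    · exact deriv_deriv_add_eq_zero_of_eqOn isOpen_Ioo (hleft.mono fun x hx => hx.2.le) hz
    · exact deriv_deriv_add_eq_zero_of_eqOn isOpen_Ioo (hright.mono fun x hx => hx.1.le) hz
  · exact fun z hz => deriv_deriv_add_eq_zero_of_eqOn isOpen_Iio (fun x _ => congrFun hu2' x) hz
  · exact continuousAt_iff_continuous_left_right.2
      ⟨hdl.continuousWithinAt, hdr.continuousWithinAt⟩
  · rw [hdr.derivWithin (uniqueDiffOn_Ici z' z' Set.self_mem_Ici),
      hdl.derivWithin (uniqueDiffOn_Iic z' z' Set.self_mem_Iic)]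
    simp only [planeWave, Complex.exp_neg]
    field_simp
    linear_combination (2 * Complex.exp (I * k1z * d) * Complex.exp (I * k1z * z')) * I_sq

end
end

section
/- Three-layer transmission problem with the source in the bottom layer: let z' < −d and define b₀ = i k₁k₁z k₂ e^{idk₁z} e^{−ik₂z(d + z')}/D', a₁ = i k₂(k₁k₁z − k₀k₀z) e^{2idk₁z} e^{−ik₂z(d + z')}/(2D'), b₁ = i k₂(k₁k₁z + k₀k₀z) e^{−ik₂z(d + z')}/(2D'), a₂ = i (k₂k₂zκ₃₁ + i k₁k₁zκ₃₂) e^{−ik₂z(2d + z')}/(2k₂z D'). Define û₀(z) = b₀ e^{ik₀z z}, û₁(z) = a₁ e^{−ik₁z(z+d)} + b₁ e^{ik₁z(z+d)}, û₂(z) = a₂ e^{−ik₂z z} + (i/(2k₂z)) e^{ik₂z|z − z'|}. Then: (1) û₀(0) = û₁(0); (2) k₀ û₀'(0) = k₁ û₁'(0); (3) û₁(−d) = û₂(−d); (4) k₁ û₁'(−d) = k₂ û₂'(−d); (5) û₀'' + k₀z² û₀ = 0 on (0, ∞), û₁'' + k₁z² û₁ = 0 on (−d, 0), and û₂'' + k₂z²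 û₂ = 0 on (−∞, z') ∪ (z', −d); (6) û₂ is continuous at z' with û₂'(z'⁺) − û₂'(z'⁻) = −1. -/
open Complex

noncomputable section

/-- The superposition of a downgoing and an upgoing plane wave of wavenumber `k`. -/
def planeWaves (k A B : ℂ) (z : ℝ) : ℂ := A * exp (-(I * k * z)) + B * exp (I * k * z)

theorem hasDerivAt_planeWaves (k A B : ℂ) (z : ℝ) :
    HasDerivAt (planeWaves k A B) (planeWaves k (-(I * k) * A) (I * k * B) z) z := by
  have h : HasDerivAt (fun x : ℝ => I * k * (x : ℂ)) (I * k) z := by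
    simpa using (Complex.ofRealCLM.hasDerivAt (x := z)).const_mul (I * k)
  refine ((h.neg.cexp.const_mul A).add (h.cexp.const_mul B)).congr_deriv ?_
  simp only [planeWaves, Pi.neg_apply]
  ring

theorem deriv_planeWaves (k A B : ℂ) :
    deriv (planeWaves k A B) = planeWaves k (-(I * k) * A) (I * k * B) :=
  funext fun z => (hasDerivAt_planeWaves k A B z).deriv

theorem helmholtz_planeWaves (k A B : ℂ) (z : ℝ) :
    deriv (deriv (planeWaves k A B)) z + k ^ 2 * planeWaves k A B z = 0 := by
  simp only [deriv_planeWaves, planeWaves]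
  linear_combination (k ^ 2 * (A * exp (-(I * k * z)) + B * exp (I * k * z))) * I_sq

theorem helmholtz_of_eventuallyEq {u : ℝ → ℂ} {k A B : ℂ} {z : ℝ}
    (h : u =ᶠ[nhds z] planeWaves k A B) : deriv (deriv u) z + k ^ 2 * u z = 0 := by
  rw [h.deriv.deriv_eq, h.eq_of_nhds, helmholtz_planeWaves]

/-- three-layer transmission problem (interfaces at z = 0 and z = −d)
with the source in the bottom layer z' < −d: the spectral-domain Green's function
components û₀, û₁, û₂ built from the coefficients b₀, a₁, b₁, a₂ satisfy the transmission
conditions at both interfaces, the homogeneous ODEs in each layer away from the source,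
and the unit derivative-jump condition at the source z'. -/
theorem statement15 (k0 k1 k2 k0z k1z k2z : ℂ)
    (h0z : k0z ≠ 0) (h1z : k1z ≠ 0) (h2z : k2z ≠ 0)
    (d : ℝ) (hd : 0 < d)
    (z' : ℝ) (hz' : z' < -d)
    (κ31 κ32 D' : ℂ)
    (h31 : κ31 = ((k1 * k1z - k0 * k0z) / 2) * Complex.exp (2 * I * (d : ℂ) * k1z) +
      (k1 * k1z + k0 * k0z) / 2)
    (h32 : κ32 = I * (((k0 * k0z - k1 * k1z) / 2) * Complex.exp (2 * I * (d : ℂ) * k1z) +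
      (k0 * k0z + k1 * k1z) / 2))
    (hD : D' = k2 * k2z * κ31 - I * k1 * k1z * κ32) (hDne : D' ≠ 0)
    (b0 a1 b1 a2 : ℂ)
    (hb0 : b0 = I * k1 * k1z * k2 * Complex.exp (I * (d : ℂ) * k1z) *
      Complex.exp (-(I * k2z * ((d : ℂ) + (z' : ℂ)))) / D')
    (ha1 : a1 = I * k2 * (k1 * k1z - k0 * k0z) * Complex.exp (2 * I * (d : ℂ) * k1z) *
      Complex.exp (-(I * k2z * ((d : ℂ) + (z' : ℂ)))) / (2 * D'))
    (hb1 : b1 = I * k2 * (k1 * k1z + k0 * k0z) *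
      Complex.exp (-(I * k2z * ((d : ℂ) + (z' : ℂ)))) / (2 * D'))
    (ha2 : a2 = I * (k2 * k2z * κ31 + I * k1 * k1z * κ32) *
      Complex.exp (-(I * k2z * (2 * (d : ℂ) + (z' : ℂ)))) / (2 * k2z * D'))
    (u0 u1 u2 : ℝ → ℂ)
    (hu0 : ∀ z : ℝ, u0 z = b0 * Complex.exp (I * k0z * (z : ℂ)))
    (hu1 : ∀ z : ℝ, u1 z = a1 * Complex.exp (-(I * k1z * ((z : ℂ) + (d : ℂ)))) +
      b1 * Complex.exp (I * k1z * ((z : ℂ) + (d : ℂ))))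
    (hu2 : ∀ z : ℝ, u2 z = a2 * Complex.exp (-(I * k2z * (z : ℂ))) +
      (I / (2 * k2z)) * Complex.exp (I * k2z * ((|z - z'| : ℝ) : ℂ))) :
    u0 0 = u1 0 ∧
    k0 * deriv u0 0 = k1 * deriv u1 0 ∧
    u1 (-d) = u2 (-d) ∧
    k1 * deriv u1 (-d) = k2 * deriv u2 (-d) ∧
    ((∀ z ∈ Set.Ioi (0 : ℝ), deriv (deriv u0) z + k0z ^ 2 * u0 z = 0) ∧
      (∀ z ∈ Set.Ioo (-d) (0 : ℝ), deriv (deriv u1) z + k1z ^ 2 * u1 z = 0) ∧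
      (∀ z ∈ Set.Iio z' ∪ Set.Ioo z' (-d),
        deriv (deriv u2) z + k2z ^ 2 * u2 z = 0)) ∧
    (ContinuousAt u2 z' ∧
      derivWithin u2 (Set.Ici z') z' - derivWithin u2 (Set.Iic z') z' = -1) := by
  have hF : exp (-(I * k2z * (2 * (d : ℂ) + z'))) =
      exp (-(I * k2z * (d + z'))) * exp (-(I * k2z * d)) := by
    rw [← exp_add]; congr 1; ring
  have hE2 : exp (2 * I * (d : ℂ) * k1z) = exp (I * k1z * d) * exp (I * k1z * d) := by
    rw [← exp_add]; congr 1; ring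
  have hE : exp (I * (d : ℂ) * k1z) = exp (I * k1z * d) := by congr 1; ring
  have hE1 : exp (-(I * k1z * d)) * exp (I * k1z * d) = 1 := by rw [← exp_add]; simp
  have hG : exp (-(I * k2z * d)) * exp (I * k2z * d) = 1 := by rw [← exp_add]; simp
  have hH : exp (-(I * k2z * z')) * exp (I * k2z * z') = 1 := by rw [← exp_add]; simp
  have hFs : exp (-(I * k2z * ((d : ℂ) + z'))) =
      exp (-(I * k2z * d)) * exp (-(I * k2z * z')) := by
    rw [← exp_add]; congr 1; ring
  have hw0 : u0 = planeWaves k0z 0 b0 := by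
    ext z; simp [hu0, planeWaves]
  have hw1 : u1 = planeWaves k1z (a1 * exp (-(I * k1z * d))) (b1 * exp (I * k1z * d)) := by
    ext z
    simp only [hu1, planeWaves, mul_add, neg_add, exp_add]
    ring
  have hright : ∀ z ∈ Set.Ici z',
      u2 z = planeWaves k2z a2 (I / (2 * k2z) * exp (-(I * k2z * z'))) z := by
    intro z hz
    rw [hu2, abs_of_nonneg (sub_nonneg.2 hz)]
    simp only [planeWaves, ofReal_sub]
    rw [mul_sub, sub_eq_add_neg, exp_add]
    ring
  have hleft : ∀ z ∈ Set.Iic z',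
      u2 z = planeWaves k2z (a2 + I / (2 * k2z) * exp (I * k2z * z')) 0 z := by
    intro z hz
    rw [hu2, abs_of_nonpos (sub_nonpos.2 hz)]
    simp only [planeWaves, neg_sub, ofReal_sub]
    rw [mul_sub, sub_eq_add_neg, exp_add]
    ring
  have hrn : ∀ z, z' < z →
      u2 =ᶠ[nhds z] planeWaves k2z a2 (I / (2 * k2z) * exp (-(I * k2z * z'))) := fun z hz =>
    Filter.eventuallyEq_of_mem (Ici_mem_nhds hz) hright
  have hln : ∀ z, z < z' →
      u2 =ᶠ[nhds z] planeWaves k2z (a2 + I / (2 * k2z) * exp (I * k2z * z')) 0 := fun z hz =>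
    Filter.eventuallyEq_of_mem (Iic_mem_nhds hz) hleft
  have hsum : a1 + b1 = I * k2 * exp (-(I * k2z * ((d : ℂ) + z'))) * κ31 / D' := by
    rw [ha1, hb1, h31]; field_simp
  have hdiff : b1 - a1 = k2 * exp (-(I * k2z * ((d : ℂ) + z'))) * κ32 / D' := by
    rw [ha1, hb1, h32]; field_simp; ring
  have ha2' : a2 * exp (I * k2z * d) = I * (k2 * k2z * κ31 + I * k1 * k1z * κ32) *
      exp (-(I * k2z * ((d : ℂ) + z'))) / (2 * k2z * D') := by
    rw [ha2, hF]; field_simp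
    linear_combination (k2 * k2z * κ31 + I * k1 * k1z * κ32) * hG
  refine ⟨?_, ?_, ?_, ?_, ⟨?_, ?_, ?_⟩, ?_, ?_⟩
  · rw [hw0, hw1]
    simp only [planeWaves, ofReal_zero, mul_zero, neg_zero, exp_zero]
    rw [hb0, ha1, hb1, hE2, hE]
    field_simp
    linear_combination -(I * k2 * exp (I * k1z * d) * exp (-(I * k2z * (d + z'))) * (k1 * k1z - k0 * k0z)) * hE1
  · rw [hw0, hw1, deriv_planeWaves, deriv_planeWaves]
    simp only [planeWaves, ofReal_zero, mul_zero, neg_zero, exp_zero]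
    rw [hb0, ha1, hb1, hE2, hE]
    field_simp
    linear_combination -(I ^ 2 * k1 * k1z * k2 * exp (I * k1z * d) * exp (-(I * k2z * (d + z'))) *
      (k0 * k0z - k1 * k1z)) * hE1
  · have h1 : u1 (-d) = a1 + b1 := by simp [hu1]
    have h2 : u2 (-d) = a2 * exp (I * k2z * d) +
        I / (2 * k2z) * exp (-(I * k2z * ((d : ℂ) + z'))) := by
      rw [hu2, abs_of_nonneg (by linarith)]
      push_cast
      congr 3 <;> ring_nf
    rw [h1, h2, hsum, ha2']
    field_simp
    rw [hD]
    ring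
  · have h1 : deriv u1 (-d) = I * k1z * (b1 - a1) := by
      rw [hw1, deriv_planeWaves]
      simp only [planeWaves, ofReal_neg, mul_neg, neg_neg]
      linear_combination (I * k1z * (b1 - a1)) * hE1
    have h2 : deriv u2 (-d) = -(I * k2z) * (a2 * exp (I * k2z * d)) -
        1 / 2 * exp (-(I * k2z * ((d : ℂ) + z'))) := by
      rw [(hrn _ hz').deriv_eq, deriv_planeWaves, hFs]
      simp only [planeWaves, ofReal_neg, mul_neg, neg_neg]
      field_simp
      linear_combination exp (-(I * k2z * d)) * exp (-(I * k2z * z')) * I_sq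
    rw [h1, h2, hdiff, ha2']
    field_simp
    rw [hD]
    linear_combination (k1 * I * k1z * k2 * κ32 + k2 ^ 2 * k2z * κ31) * I_sq
  · intro z _
    rw [hw0, helmholtz_planeWaves]
  · intro z _
    rw [hw1, helmholtz_planeWaves]
  · rintro z (hz | hz)
    · exact helmholtz_of_eventuallyEq (hln z hz)
    · exact helmholtz_of_eventuallyEq (hrn z hz.1)
  · rw [funext hu2]
    fun_prop
  · rw [derivWithin_congr hright (hright z' Set.self_mem_Ici),
      derivWithin_congr hleft (hleft z' Set.self_mem_Iic),
      (hasDerivAt_planeWaves _ _ _ _).hasDerivWithinAt.derivWithin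
        (uniqueDiffOn_Ici z' z' Set.self_mem_Ici),
      (hasDerivAt_planeWaves _ _ _ _).hasDerivWithinAt.derivWithin
        (uniqueDiffOn_Iic z' z' Set.self_mem_Iic)]
    simp only [planeWaves]
    field_simp
    linear_combination 2 * I ^ 2 * hH + 2 * I_sq

end
end
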